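/- Let n ≥ 2, let α_n be an optimal set of n-means for P, and let k ≥ 1 be such that card(α_n ∩ J_{(k,∞)}) ≥ 2, where J_{(k,∞)} = ⋃_{j=k+1}^∞ S_j([0,1]). Then α_n ∩ J_{k+1} ≠ ∅ and α_n ∩ J_{(k+1,∞)} ≠ ∅, and α_n contains no point of the open interval (S_{k+1}(1), S_{k+2}(0)). Moreover, for every a ∈ α_n ∩ J_{k+1} the Voronoi region M(a|α_n) contains no point of J_{(k+1,∞)}, and for every a ∈ α_n ∩ J_{(k+1,∞)} the Voronoi region M(a|α_n) contains no point of J_{k+1}. -/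

import Mathlib

open MeasureTheory

noncomputable section

/-- The contractive similarity `S j x = x / 2^(j+1) + 1 - 1/2^(j-1)` (used for `j ≥ 1`). -/
def S (j : ℕ) (x : ℝ) : ℝ := x / 2 ^ (j + 1) + 1 - 1 / 2 ^ (j - 1)

/-- The similarity ratio `s j = 1/2^(j+1)`. -/
def s (j : ℕ) : ℝ := 1 / 2 ^ (j + 1)

/-- The probability vector: `p 1 = 1/4`, `p j = 3/2^(j+1)` for `j ≥ 2`. -/
def p (j : ℕ) : ℝ := if j = 1 then 1 / 4 else 3 / 2 ^ (j + 1)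

/-- `Sw ω = S_{ω_1} ∘ ⋯ ∘ S_{ω_k}`. -/
def Sw (ω : List ℕ) : ℝ → ℝ := ω.foldr (fun j f => S j ∘ f) id

/-- `pw ω = p_{ω_1} ⋯ p_{ω_k}`. -/
def pw (ω : List ℕ) : ℝ := (ω.map p).prod

/-- `sw ω = s_{ω_1} ⋯ s_{ω_k}`. -/
def sw (ω : List ℕ) : ℝ := (ω.map s).prod

/-- The basic interval `J_ω = S_ω([0,1])`. -/
def Jw (ω : List ℕ) : Set ℝ := Sw ω '' Set.Icc 0 1

/-- The last letter of a word (junk value `0` for the empty word). -/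
def wlast (ω : List ℕ) : ℕ := ω.getLastD 0

/-- `wext ω j = ω^-(ω_k + j)`: the word `ω` with its last letter increased by `j`. -/
def wext (ω : List ℕ) (j : ℕ) : List ℕ := ω.dropLast ++ [wlast ω + j]

/-- `J_{(ω,∞)} = ⋃_{j=1}^∞ J_{ω^-(ω_k+j)}`. -/
def Jinf (ω : List ℕ) : Set ℝ := ⋃ j : ℕ, Jw (wext ω (j + 1))

/-- `a(ω) = S_ω(4/7)`. -/
def aw (ω : List ℕ) : ℝ := Sw ω (4 / 7)

/-- `a(ω,∞) = S_{ω^-(ω_k+1)}(4/7) + (8/7) s_{ω^-(ω_k+1)}`. -/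
def ainf (ω : List ℕ) : ℝ := Sw (wext ω 1) (4 / 7) + (8 / 7) * sw (wext ω 1)

/-- A (nonempty) word over the alphabet `{1, 2, 3, …}`. -/
def IsWord (ω : List ℕ) : Prop := ω ≠ [] ∧ ∀ i ∈ ω, 1 ≤ i

/-- The invariance relation `P(A) = ∑_{j=1}^∞ p_j P(S_j⁻¹ A)`. -/
def Invariant (P : Measure ℝ) : Prop :=
  ∀ A : Set ℝ, MeasurableSet A →
    P A = ∑' j : ℕ, ENNReal.ofReal (p (j + 1)) * P (S (j + 1) ⁻¹' A)

/-- The distortion error `∫ min_{a ∈ α} (x-a)² dP` of a set `α ⊆ ℝ`. -/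
def distortion (P : Measure ℝ) (α : Set ℝ) : ℝ :=
  ∫ x, (⨅ a : α, (x - (a : ℝ)) ^ 2) ∂P

/-- The `n`-th quantization error for `P`. -/
def quantErr (P : Measure ℝ) (n : ℕ) : ℝ :=
  sInf {r : ℝ | ∃ α : Set ℝ, 1 ≤ α.ncard ∧ α.ncard ≤ n ∧ r = distortion P α}

/-- `α` is an optimal set of `n`-means for `P`. -/
def IsOptimal (P : Measure ℝ) (n : ℕ) (α : Set ℝ) : Prop :=
  1 ≤ α.ncard ∧ α.ncard ≤ n ∧ distortion P α = quantErr P n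

/-- `E(a(ω)) = ∫_{J_ω} (x - a(ω))² dP`. -/
def Ea (P : Measure ℝ) (ω : List ℕ) : ℝ := ∫ x in Jw ω, (x - aw ω) ^ 2 ∂P

/-- `E(a(ω,∞)) = ∫_{J_{(ω,∞)}} (x - a(ω,∞))² dP`. -/
def Eainf (P : Measure ℝ) (ω : List ℕ) : ℝ := ∫ x in Jinf ω, (x - ainf ω) ^ 2 ∂P

/-- The Voronoi region `M(a|α)`. -/
def voronoi (α : Set ℝ) (a : ℝ) : Set ℝ := {x : ℝ | ∀ b ∈ α, |x - a| ≤ |x - b|}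


/-! ## Core combinatorial/numerical part, in rescaled coordinates -/

/-- squared distance to a set -/
def dd (s : Set ℝ) (x : ℝ) : ℝ := ⨅ a : s, (x - (a : ℝ)) ^ 2

lemma dd_le {s : Set ℝ} {a : ℝ} (ha : a ∈ s) (x : ℝ) : dd s x ≤ (x - a) ^ 2 :=
  ciInf_le (f := fun a : s => (x - (a : ℝ)) ^ 2)
    ⟨0, by rintro _ ⟨b, rfl⟩; positivity⟩ ⟨a, ha⟩

lemma le_dd {s : Set ℝ} (hs : s.Nonempty) {x q : ℝ} (h : ∀ a ∈ s, q ≤ (x - a) ^ 2) :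
    q ≤ dd s x := by
  haveI := hs.to_subtype
  exact le_ciInf fun a => h a a.2

lemma dd_mono {s t : Set ℝ} (hs : s.Nonempty) {x : ℝ}
    (h : ∀ a ∈ s, ∃ b ∈ t, |x - b| ≤ |x - a|) : dd t x ≤ dd s x := by
  refine le_dd hs fun a ha => ?_
  obtain ⟨b, hb, hab⟩ := h a ha
  exact (dd_le hb x).trans (sq_le_sq.2 hab)

lemma dd_cont (s : Finset ℝ) (hs : s.Nonempty) : Continuous (dd (s : Set ℝ)) := by
  have : dd (s : Set ℝ) = fun x => s.inf' hs (fun a => (x - a) ^ 2) := by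
    funext x
    apply le_antisymm
    · refine Finset.le_inf' _ _ fun a ha => dd_le (by exact_mod_cast ha) x
    · refine le_dd (by exact_mod_cast hs) fun a ha => Finset.inf'_le _ (by exact_mod_cast ha)
  rw [this]
  exact Continuous.finset_inf'_apply hs fun a _ => by fun_prop

/-- The two averaging functionals: `IX` is integration against `P`, `IT` against the normalized
tail of `P`. -/
structure Fn (IX IT : (ℝ → ℝ) → ℝ) : Prop where
  X_split : ∀ g, Continuous g →
    IX g = 1 / 4 * IX (fun x => g (x / 4)) + 3 / 4 * IT (fun t => g (1 / 2 + t / 2))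
  T_split : ∀ g, Continuous g →
    IT g = 1 / 2 * IX (fun x => g (x / 4)) + 1 / 2 * IT (fun t => g (1 / 2 + t / 2))
  X_mono : ∀ g h, Continuous g → Continuous h → (∀ x, 0 ≤ x → x ≤ 1 → g x ≤ h x) → IX g ≤ IX h
  T_mono : ∀ g h, Continuous g → Continuous h → (∀ x, 0 ≤ x → x ≤ 1 → g x ≤ h x) → IT g ≤ IT h
  X_quad : ∀ A B C : ℝ, IX (fun x => A + B * x + C * x ^ 2) = A + B * (4 / 7) + C * (208 / 511)
  T_quad : ∀ A B C : ℝ, IT (fun x => A + B * x + C * x ^ 2) = A + B * (3 / 7) + C * (143 / 511)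

namespace Fn

variable {IX IT : (ℝ → ℝ) → ℝ}

lemma X_split3 (F : Fn IX IT) (g : ℝ → ℝ) (hg : Continuous g) :
    IX g = 1 / 4 * IX (fun x => g (x / 4)) + 3 / 8 * IX (fun x => g (1 / 2 + x / 8))
      + 3 / 8 * IT (fun t => g (3 / 4 + t / 4)) := by
  rw [F.X_split g hg, F.T_split (fun t => g (1 / 2 + t / 2)) (by fun_prop)]
  have e1 : (fun x : ℝ => g (1 / 2 + x / 4 / 2)) = fun x => g (1 / 2 + x / 8) := by
    funext x; congr 1; ring
  have e2 : (fun x : ℝ => g (1 / 2 + (1 / 2 + x / 2) / 2)) = fun x => g (3 / 4 + x / 4) := by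
    funext x; congr 1; ring
  simp only [e1, e2]; ring

lemma T_split3 (F : Fn IX IT) (g : ℝ → ℝ) (hg : Continuous g) :
    IT g = 1 / 2 * IX (fun x => g (x / 4)) + 1 / 4 * IX (fun x => g (1 / 2 + x / 8))
      + 1 / 4 * IT (fun t => g (3 / 4 + t / 4)) := by
  rw [F.T_split g hg, F.T_split (fun t => g (1 / 2 + t / 2)) (by fun_prop)]
  have e1 : (fun x : ℝ => g (1 / 2 + x / 4 / 2)) = fun x => g (1 / 2 + x / 8) := by
    funext x; congr 1; ring
  have e2 : (fun x : ℝ => g (1 / 2 + (1 / 2 + x / 2) / 2)) = fun x => g (3 / 4 + x / 4) := by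
    funext x; congr 1; ring
  simp only [e1, e2]; ring

/-- split of the right half -/
lemma R_split (F : Fn IX IT) (g : ℝ → ℝ) (hg : Continuous g) :
    IT (fun t => g (1 / 2 + t / 2)) = 1 / 2 * IX (fun x => g (1 / 2 + x / 8))
      + 1 / 2 * IT (fun t => g (3 / 4 + t / 4)) := by
  rw [F.T_split (fun t => g (1 / 2 + t / 2)) (by fun_prop)]
  have e1 : (fun x : ℝ => g (1 / 2 + x / 4 / 2)) = fun x => g (1 / 2 + x / 8) := by
    funext x; congr 1; ring
  have e2 : (fun x : ℝ => g (1 / 2 + (1 / 2 + x / 2) / 2)) = fun x => g (3 / 4 + x / 4) := by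
    funext x; congr 1; ring
  simp only [e1, e2]

/-- split of the rightmost quarter -/
lemma R2_split (F : Fn IX IT) (g : ℝ → ℝ) (hg : Continuous g) :
    IT (fun t => g (3 / 4 + t / 4)) = 1 / 2 * IX (fun x => g (3 / 4 + x / 16))
      + 1 / 2 * IT (fun t => g (7 / 8 + t / 8)) := by
  rw [F.T_split (fun t => g (3 / 4 + t / 4)) (by fun_prop)]
  have e1 : (fun x : ℝ => g (3 / 4 + x / 4 / 4)) = fun x => g (3 / 4 + x / 16) := by
    funext x; congr 1; ring
  have e2 : (fun x : ℝ => g (3 / 4 + (1 / 2 + x / 2) / 4)) = fun x => g (7 / 8 + x / 8) := by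
    funext x; congr 1; ring
  simp only [e1, e2]

lemma X_lb (F : Fn IX IT) {g : ℝ → ℝ} (hg : Continuous g) (A B C : ℝ)
    (h : ∀ x, 0 ≤ x → x ≤ 1 → A + B * x + C * x ^ 2 ≤ g x) :
    A + B * (4 / 7) + C * (208 / 511) ≤ IX g := by
  rw [← F.X_quad]; exact F.X_mono _ _ (by fun_prop) hg h

lemma T_lb (F : Fn IX IT) {g : ℝ → ℝ} (hg : Continuous g) (A B C : ℝ)
    (h : ∀ x, 0 ≤ x → x ≤ 1 → A + B * x + C * x ^ 2 ≤ g x) :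
    A + B * (3 / 7) + C * (143 / 511) ≤ IT g := by
  rw [← F.T_quad]; exact F.T_mono _ _ (by fun_prop) hg h

variable {α : Finset ℝ}

lemma cont_phi (hα : α.Nonempty) {φ : ℝ → ℝ} (hφ : Continuous φ) :
    Continuous (fun x => dd (α : Set ℝ) (φ x)) := (dd_cont α hα).comp hφ

/-- upper bounds by one point -/
lemma X_ub (F : Fn IX IT) (hα : α.Nonempty) {c : ℝ} (hc : c ∈ α) (u v : ℝ) :
    IX (fun x => dd (α : Set ℝ) (u + x * v)) ≤
      (u - c) ^ 2 + 2 * v * (u - c) * (4 / 7) + v ^ 2 * (208 / 511) := by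
  rw [← F.X_quad]
  refine F.X_mono _ _ (cont_phi hα (by fun_prop)) (by fun_prop) fun x _ _ => ?_
  refine (dd_le (by exact_mod_cast hc) _).trans (le_of_eq (by ring))

lemma T_ub (F : Fn IX IT) (hα : α.Nonempty) {c : ℝ} (hc : c ∈ α) (u v : ℝ) :
    IT (fun x => dd (α : Set ℝ) (u + x * v)) ≤
      (u - c) ^ 2 + 2 * v * (u - c) * (3 / 7) + v ^ 2 * (143 / 511) := by
  rw [← F.T_quad]
  refine F.T_mono _ _ (cont_phi hα (by fun_prop)) (by fun_prop) fun x _ _ => ?_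
  refine (dd_le (by exact_mod_cast hc) _).trans (le_of_eq (by ring))

/-- exact lower bounds by squares -/
lemma X_sq (F : Fn IX IT) (hα : α.Nonempty) {φ : ℝ → ℝ} (hφ : Continuous φ) (u v : ℝ)
    (h : ∀ x, 0 ≤ x → x ≤ 1 → ∀ a ∈ α, |u * x + v| ≤ |φ x - a|) :
    v ^ 2 + 2 * u * v * (4 / 7) + u ^ 2 * (208 / 511) ≤ IX (fun x => dd (α : Set ℝ) (φ x)) := by
  refine F.X_lb (cont_phi hα hφ) _ _ _ fun x h0 h1 => le_dd (by exact_mod_cast hα) fun a ha => ?_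
  have := sq_le_sq.2 (h x h0 h1 a (by exact_mod_cast ha))
  nlinarith

lemma T_sq (F : Fn IX IT) (hα : α.Nonempty) {φ : ℝ → ℝ} (hφ : Continuous φ) (u v : ℝ)
    (h : ∀ x, 0 ≤ x → x ≤ 1 → ∀ a ∈ α, |u * x + v| ≤ |φ x - a|) :
    v ^ 2 + 2 * u * v * (3 / 7) + u ^ 2 * (143 / 511) ≤ IT (fun x => dd (α : Set ℝ) (φ x)) := by
  refine F.T_lb (cont_phi hα hφ) _ _ _ fun x h0 h1 => le_dd (by exact_mod_cast hα) fun a ha => ?_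
  have := sq_le_sq.2 (h x h0 h1 a (by exact_mod_cast ha))
  nlinarith

lemma jen_aux {c y z : ℝ} (hc : 0 ≤ c) (h : y ≤ |z|) : 2 * c * y - c ^ 2 ≤ z ^ 2 := by
  have h2 := mul_le_mul_of_nonneg_left h hc
  nlinarith [sq_nonneg (|z| - c), sq_abs z]

/-- Jensen (tangent) lower bounds: for any `c ≥ 0`. -/
lemma X_jen (F : Fn IX IT) (hα : α.Nonempty) {φ : ℝ → ℝ} (hφ : Continuous φ) (u v c : ℝ)
    (hc : 0 ≤ c) (h : ∀ x, 0 ≤ x → x ≤ 1 → ∀ a ∈ α, u * x + v ≤ |φ x - a|) :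
    2 * c * (u * (4 / 7) + v) - c ^ 2 ≤ IX (fun x => dd (α : Set ℝ) (φ x)) := by
  have := F.X_lb (cont_phi hα hφ) (2 * c * v - c ^ 2) (2 * c * u) 0 fun x h0 h1 =>
    le_dd (by exact_mod_cast hα) fun a ha => ?_
  · linarith
  · have := jen_aux hc (h x h0 h1 a (by exact_mod_cast ha)); nlinarith

lemma T_jen (F : Fn IX IT) (hα : α.Nonempty) {φ : ℝ → ℝ} (hφ : Continuous φ) (u v c : ℝ)
    (hc : 0 ≤ c) (h : ∀ x, 0 ≤ x → x ≤ 1 → ∀ a ∈ α, u * x + v ≤ |φ x - a|) :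
    2 * c * (u * (3 / 7) + v) - c ^ 2 ≤ IT (fun x => dd (α : Set ℝ) (φ x)) := by
  have := F.T_lb (cont_phi hα hφ) (2 * c * v - c ^ 2) (2 * c * u) 0 fun x h0 h1 =>
    le_dd (by exact_mod_cast hα) fun a ha => ?_
  · linarith
  · have := jen_aux hc (h x h0 h1 a (by exact_mod_cast ha)); nlinarith

lemma X_nonneg (F : Fn IX IT) (hα : α.Nonempty) {φ : ℝ → ℝ} (hφ : Continuous φ) :
    0 ≤ IX (fun x => dd (α : Set ℝ) (φ x)) := by
  have := F.X_jen hα hφ 0 0 0 le_rfl (fun x _ _ a _ => by simp)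
  linarith

lemma T_nonneg (F : Fn IX IT) (hα : α.Nonempty) {φ : ℝ → ℝ} (hφ : Continuous φ) :
    0 ≤ IT (fun x => dd (α : Set ℝ) (φ x)) := by
  have := F.T_jen hα hφ 0 0 0 le_rfl (fun x _ _ a _ => by simp)
  linarith

/-! Upper bounds for the competitors -/

lemma ubR1 (F : Fn IX IT) (hα : α.Nonempty) (h1 : 5 / 7 ∈ α) :
    IT (fun t => dd (α : Set ℝ) (1 / 2 + t / 2)) ≤ 344 / 3577 / 4 := by
  have := F.T_ub hα h1 (1 / 2) (1 / 2)
  simp only [mul_one_div] at this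
  linarith

lemma ubR2 (F : Fn IX IT) (hα : α.Nonempty) (h1 : 4 / 7 ∈ α) (h2 : 6 / 7 ∈ α) :
    IT (fun t => dd (α : Set ℝ) (1 / 2 + t / 2)) ≤ 288 / 3577 / 128 + 344 / 3577 / 32 := by
  rw [F.R_split _ (dd_cont α hα)]
  have a := F.X_ub hα h1 (1 / 2) (1 / 8)
  have b := F.T_ub hα h2 (3 / 4) (1 / 4)
  simp only [mul_one_div] at a b
  linarith

lemma ubX1 (F : Fn IX IT) (hα : α.Nonempty) (h1 : 1 / 7 ∈ α) :
    IX (fun t => dd (α : Set ℝ) (t / 4)) ≤ 288 / 3577 / 16 := by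
  have := F.X_ub hα h1 0 (1 / 4)
  simp only [mul_one_div, zero_add] at this
  linarith

lemma ub2 (F : Fn IX IT) (hα : α.Nonempty) (h0 : 1 / 7 ∈ α) (h1 : 5 / 7 ∈ α) :
    IT (dd (α : Set ℝ)) ≤ 288 / 3577 / 32 + 344 / 3577 / 8 := by
  rw [F.T_split _ (dd_cont α hα)]
  linarith [F.ubX1 hα h0, F.ubR1 hα h1]

lemma ub3 (F : Fn IX IT) (hα : α.Nonempty) (h0 : 1 / 7 ∈ α) (h1 : 4 / 7 ∈ α) (h2 : 6 / 7 ∈ α) :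
    IT (dd (α : Set ℝ)) ≤ 288 / 3577 / 32 + 288 / 3577 / 256 + 344 / 3577 / 64 := by
  rw [F.T_split _ (dd_cont α hα)]
  linarith [F.ubX1 hα h0, F.ubR2 hα h1 h2]

lemma ub4 (F : Fn IX IT) (hα : α.Nonempty) (h0 : 1 / 28 ∈ α) (h0' : 5 / 28 ∈ α)
    (h1 : 4 / 7 ∈ α) (h2 : 6 / 7 ∈ α) :
    IT (dd (α : Set ℝ)) ≤ (288 / 3577 / 64 + 3 * (344 / 3577) / 16) / 32
      + 288 / 3577 / 256 + 344 / 3577 / 64 := by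
  rw [F.T_split _ (dd_cont α hα),
    F.X_split (fun x => dd (α : Set ℝ) (x / 4)) (cont_phi hα (by fun_prop))]
  have a := F.X_ub hα h0 0 (1 / 16)
  have b := F.T_ub hα h0' (1 / 8) (1 / 8)
  have e1 : (fun x : ℝ => dd (α : Set ℝ) (x / 4 / 4)) = fun x => dd (α : Set ℝ) (0 + x * (1 / 16)) := by
    funext x; congr 1; ring
  have e2 : (fun x : ℝ => dd (α : Set ℝ) ((1 / 2 + x / 2) / 4))
      = fun x => dd (α : Set ℝ) (1 / 8 + x * (1 / 8)) := by
    funext x; congr 1; ring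
  rw [e1, e2]
  linarith [F.ubR2 hα h1 h2]

end Fn

namespace Fn
variable {IX IT : (ℝ → ℝ) → ℝ}
lemma X_split4 (F : Fn IX IT) (g : ℝ → ℝ) (hg : Continuous g) :
    IX g = 1 / 4 * IX (fun x => g (x / 4)) + 3 / 8 * IX (fun x => g (1 / 2 + x / 8))
      + 3 / 16 * IX (fun x => g (3 / 4 + x / 16)) + 3 / 16 * IT (fun t => g (7 / 8 + t / 8)) := by
  rw [F.X_split3 g hg, F.R2_split g hg]; ring
end Fn

/-- Optimality of `α` in the rescaled coordinates. -/
structure Opt (IX IT Λ : (ℝ → ℝ) → ℝ) (ρ : ℝ) (α : Finset ℝ) : Prop where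
  ne : α.Nonempty
  opt : ∀ β : Finset ℝ, β.Nonempty → β.card ≤ α.card →
    Λ (dd (α : Set ℝ)) + ρ * IX (fun x => dd (α : Set ℝ) (x / 2 - 1)) + IT (dd (α : Set ℝ)) ≤
    Λ (dd (β : Set ℝ)) + ρ * IX (fun x => dd (β : Set ℝ) (x / 2 - 1)) + IT (dd (β : Set ℝ))
  mono : ∀ β : Finset ℝ, β.Nonempty → (∀ t ≤ -1, dd (β : Set ℝ) t ≤ dd (α : Set ℝ) t) →
    Λ (dd (β : Set ℝ)) ≤ Λ (dd (α : Set ℝ))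
  rho : 1 / 3 ≤ ρ
  g0 : ∀ b ∈ α, -1 / 2 < b → b < 0 → ∀ a ∈ α, a < b → a + b < -1
  g1l : ∀ b ∈ α, 1 / 4 < b → b < 1 / 2 → ∀ a ∈ α, a < b → a + b < 1 / 2
  g1r : ∀ b ∈ α, 1 / 4 < b → b < 1 / 2 → ∀ a ∈ α, b < a → 1 < b + a
  g2l : ∀ b ∈ α, 5 / 8 < b → b < 3 / 4 → ∀ a ∈ α, a < b → a + b < 5 / 4
  g2r : ∀ b ∈ α, 5 / 8 < b → b < 3 / 4 → ∀ a ∈ α, b < a → 3 / 2 < b + a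

namespace Opt
variable {IX IT Λ : (ℝ → ℝ) → ℝ} {ρ : ℝ} {α : Finset ℝ}

lemma cmpT (O : Opt IX IT Λ ρ α) (F : Fn IX IT) (β : Finset ℝ) (hβ : β.Nonempty)
    (hc : β.card ≤ α.card) (h : ∀ t ≤ -1 / 2, dd (β : Set ℝ) t ≤ dd (α : Set ℝ) t) :
    IT (dd (α : Set ℝ)) ≤ IT (dd (β : Set ℝ)) := by
  have h1 := O.opt β hβ hc
  have h2 := O.mono β hβ (fun t ht => h t (by linarith))
  have h3 : IX (fun x => dd (β : Set ℝ) (x / 2 - 1)) ≤ IX (fun x => dd (α : Set ℝ) (x / 2 - 1)) :=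
    F.X_mono _ _ (Fn.cont_phi hβ (by fun_prop)) (Fn.cont_phi O.ne (by fun_prop))
      fun x _ h1 => h _ (by linarith)
  have h4 := mul_le_mul_of_nonneg_left h3 (show 0 ≤ ρ by linarith [O.rho])
  linarith

lemma cmpR (O : Opt IX IT Λ ρ α) (F : Fn IX IT) (β : Finset ℝ) (hβ : β.Nonempty)
    (hc : β.card ≤ α.card) (h : ∀ t ≤ 1 / 4, dd (β : Set ℝ) t ≤ dd (α : Set ℝ) t) :
    IT (fun t => dd (α : Set ℝ) (1 / 2 + t / 2)) ≤ IT (fun t => dd (β : Set ℝ) (1 / 2 + t / 2)) := by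
  have h1 := O.cmpT F β hβ hc (fun t ht => h t (by linarith))
  rw [F.T_split _ (dd_cont α O.ne), F.T_split _ (dd_cont β hβ)] at h1
  have h3 : IX (fun x => dd (β : Set ℝ) (x / 4)) ≤ IX (fun x => dd (α : Set ℝ) (x / 4)) :=
    F.X_mono _ _ (Fn.cont_phi hβ (by fun_prop)) (Fn.cont_phi O.ne (by fun_prop))
      fun x _ h1 => h _ (by linarith)
  linarith

lemma card_repl (α C : Finset ℝ) (q : ℝ → Prop) [DecidablePred q]
    (h : C.card ≤ (α.filter (fun a => ¬ q a)).card) : (α.filter q ∪ C).card ≤ α.card := by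
  have := Finset.card_union_le (α.filter q) C
  have h2 := Finset.card_filter_add_card_filter_not (s := α) q
  omega

lemma abs_aux1 {t c b : ℝ} (h1 : t ≤ c) (h2 : c ≤ b) : |t - c| ≤ |t - b| := by
  rw [abs_sub_comm t c, abs_sub_comm t b, abs_of_nonneg (by linarith), abs_of_nonneg (by linarith)]
  linarith

lemma abs_aux2 {t a b : ℝ} (h1 : a < b) (h2 : 2 * t ≤ a + b) : |t - a| ≤ |t - b| := by
  rw [abs_sub_comm t b, abs_of_nonneg (a := b - t) (by linarith), abs_le]
  constructor <;> linarith

/-- A point near the left gap must not be responsible for the previous basic interval. -/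
lemma lemL (O : Opt IX IT Λ ρ α) (F : Fn IX IT) {b0 : ℝ} (hb : -1 / 32 ≤ b0)
    (h3 : 3 ≤ (α.filter (fun a => ¬ a < b0)).card) : ∃ a ∈ α, a < b0 ∧ -1 ≤ a + b0 := by
  by_contra! hcon
  set β : Finset ℝ := α.filter (fun a => a < b0) ∪ {-5 / 7, 1 / 7, 5 / 7} with hβ
  have m1 : (-5 / 7 : ℝ) ∈ β := by simp [hβ]
  have m2 : (1 / 7 : ℝ) ∈ β := by simp [hβ]
  have m3 : (5 / 7 : ℝ) ∈ β := by simp [hβ]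
  have hβn : β.Nonempty := ⟨_, m1⟩
  have hc : β.card ≤ α.card := card_repl _ _ _ (le_trans Finset.card_le_three h3)
  have h1 := O.opt β hβn hc
  have h2 := O.mono β hβn (fun t ht => dd_mono (by exact_mod_cast O.ne) fun a ha => by
    by_cases hab : a < b0
    · exact ⟨a, by simp only [Finset.mem_coe] at ha ⊢; simp [hβ, ha, hab], le_rfl⟩
    · exact ⟨_, m1, abs_aux1 (by linarith) (by linarith)⟩)
  have h4 := F.ub2 hβn m2 m3
  have h5 := F.X_ub hβn m1 (-1) (1 / 2)
  have e1 : (fun x : ℝ => dd (β : Set ℝ) (-1 + x * (1 / 2))) = fun x => dd (β : Set ℝ) (x / 2 - 1) := by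
    funext x; congr 1; ring
  rw [e1] at h5
  have h6 := F.X_jen O.ne (φ := fun x => x / 2 - 1) (by fun_prop) (1 / 2) (-1 / 32) (57 / 224) (by norm_num)
    (fun x hx0 hx1 a ha => by
      by_cases hab : a < b0
      · have := hcon a ha hab
        exact le_abs.2 (Or.inl (by linarith))
      · exact le_abs.2 (Or.inr (by linarith)))
  have h7 := F.T_nonneg O.ne (φ := fun x => x) (by fun_prop)
  have h8 : 0 ≤ ρ - 1 / 3 := by linarith [O.rho]
  have h9 : ρ * (IX (fun x => dd (α : Set ℝ) (x / 2 - 1)) - IX (fun x => dd (β : Set ℝ) (x / 2 - 1)))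
      ≤ 288 / 3577 / 32 + 344 / 3577 / 8 := by
    have : IT (fun x => dd (α : Set ℝ) x) = IT (dd (α : Set ℝ)) := rfl
    linarith
  have h10 : (4462 : ℝ) / 100000 ≤
    IX (fun x => dd (α : Set ℝ) (x / 2 - 1)) - IX (fun x => dd (β : Set ℝ) (x / 2 - 1)) := by
    linarith
  have h11 := mul_le_mul O.rho h10 (by norm_num) (by linarith [O.rho])
  norm_num at h9 h11
  linarith

/-- general comparison with a replaced nonnegative part -/
lemma replB (O : Opt IX IT Λ ρ α) (F : Fn IX IT) (C : Finset ℝ) (hC : C.Nonempty)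
    (hc : C.card ≤ (α.filter (fun a => ¬ a < 0)).card)
    (h3 : 3 ≤ (α.filter (fun a => ¬ a < 0)).card ∨ (1 / 7 ∈ C ∧ ∀ a ∈ α, 0 ≤ a → 1 / 7 ≤ a)) :
    IT (dd (α : Set ℝ)) ≤ IT (dd ((α.filter (fun a => a < 0) ∪ C : Finset ℝ) : Set ℝ)) := by
  have hβn : (α.filter (fun a => a < 0) ∪ C).Nonempty := by
    obtain ⟨c, hc⟩ := hC; exact ⟨c, by simp [hc]⟩
  refine O.cmpT F _ hβn (card_repl _ _ _ hc) fun t ht => dd_mono (by exact_mod_cast O.ne) fun b hb => ?_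
  have hb' : b ∈ α := by exact_mod_cast hb
  by_cases hb0 : b < 0
  · exact ⟨b, by simp only [Finset.mem_coe]; simp [hb', hb0], le_rfl⟩
  rcases h3 with h3 | ⟨h3, h4⟩
  · have hBn : (α.filter (fun a => ¬ a < 0)).Nonempty := Finset.card_pos.1 (by omega)
    obtain ⟨b0, hb0m, hmin⟩ := Finset.exists_min_image (α.filter (fun a => ¬ a < 0)) id hBn
    have hb00 : ¬ b0 < 0 := (Finset.mem_filter.1 hb0m).2
    obtain ⟨a, haα, ha, hab⟩ := O.lemL F (b0 := b0) (by linarith) (h3.trans (Finset.card_le_card (by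
      intro x hx
      have := hmin x hx
      simp only [id] at this
      exact Finset.mem_filter.2 ⟨(Finset.mem_filter.1 hx).1, by linarith⟩)))
    have hbb := hmin b (Finset.mem_filter.2 ⟨hb', hb0⟩)
    simp only [id] at hbb
    have ha0 : a < 0 := by
      by_contra hneg
      have := hmin a (Finset.mem_filter.2 ⟨haα, hneg⟩)
      simp only [id] at this
      linarith
    exact ⟨a, by simp only [Finset.mem_coe]; simp [haα, ha0], abs_aux2 (by linarith) (by linarith)⟩
  · exact ⟨1 / 7, by simp only [Finset.mem_coe]; exact Finset.mem_union_right _ h3, abs_aux1 (by linarith) (h4 b hb' (by linarith))⟩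

lemma cor2 (O : Opt IX IT Λ ρ α) (F : Fn IX IT)
    (h2 : 2 ≤ (α.filter (fun a => ¬ a < 0)).card) (h : ∀ a ∈ α, 0 ≤ a → 1 / 7 ≤ a) :
    IT (dd (α : Set ℝ)) ≤ 288 / 3577 / 32 + 344 / 3577 / 8 := by
  refine (O.replB F {1 / 7, 5 / 7} (by simp) (Finset.card_le_two.trans h2) (Or.inr ⟨by simp, h⟩)).trans ?_
  exact F.ub2 ⟨1 / 7, by simp⟩ (by simp) (by simp)

lemma cor3 (O : Opt IX IT Λ ρ α) (F : Fn IX IT)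
    (h3 : 3 ≤ (α.filter (fun a => ¬ a < 0)).card) :
    IT (dd (α : Set ℝ)) ≤ 288 / 3577 / 32 + 288 / 3577 / 256 + 344 / 3577 / 64 := by
  refine (O.replB F {1 / 7, 4 / 7, 6 / 7} (by simp) (Finset.card_le_three.trans h3) (Or.inl h3)).trans ?_
  exact F.ub3 ⟨1 / 7, by simp⟩ (by simp) (by simp) (by simp)

lemma cor4 (O : Opt IX IT Λ ρ α) (F : Fn IX IT)
    (h3 : 4 ≤ (α.filter (fun a => ¬ a < 0)).card) :
    IT (dd (α : Set ℝ)) ≤ (288 / 3577 / 64 + 3 * (344 / 3577) / 16) / 32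
      + 288 / 3577 / 256 + 344 / 3577 / 64 := by
  refine (O.replB F {1 / 28, 5 / 28, 4 / 7, 6 / 7} (by simp) (Finset.card_le_four.trans h3)
    (Or.inl (by omega))).trans ?_
  exact F.ub4 ⟨1 / 28, by simp⟩ (by simp) (by simp) (by simp) (by simp)

/-- replacing the points `≥ 1/2` when there are none in the gap and one in `[0,1/4]` -/
lemma replR (O : Opt IX IT Λ ρ α) (F : Fn IX IT) (C : Finset ℝ)
    (hgap : ∀ a ∈ α, a ≤ 1 / 4 ∨ 1 / 2 ≤ a) (ha : ∃ a ∈ α, 0 ≤ a ∧ a ≤ 1 / 4)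
    (hc : C.card ≤ (α.filter (fun a => ¬ a < 1 / 2)).card) :
    IT (fun t => dd (α : Set ℝ) (1 / 2 + t / 2)) ≤
      IT (fun t => dd ((α.filter (fun a => a < 1 / 2) ∪ C : Finset ℝ) : Set ℝ) (1 / 2 + t / 2)) := by
  obtain ⟨a, haα, ha0, ha1⟩ := ha
  have ham : a ∈ α.filter (fun a => a < 1 / 2) ∪ C :=
    Finset.mem_union_left _ (Finset.mem_filter.2 ⟨haα, by linarith⟩)
  refine O.cmpR F _ ⟨a, ham⟩ (card_repl _ _ _ hc) fun t ht =>
    dd_mono (by exact_mod_cast O.ne) fun b hb => ?_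
  have hb' : b ∈ α := by exact_mod_cast hb
  by_cases hb0 : b < 1 / 2
  · exact ⟨b, Finset.mem_coe.2 (Finset.mem_union_left _ (Finset.mem_filter.2 ⟨hb', hb0⟩)), le_rfl⟩
  · exact ⟨a, ham, abs_aux2 (by linarith) (by linarith)⟩

lemma corR1 (O : Opt IX IT Λ ρ α) (F : Fn IX IT)
    (hgap : ∀ a ∈ α, a ≤ 1 / 4 ∨ 1 / 2 ≤ a) (ha : ∃ a ∈ α, 0 ≤ a ∧ a ≤ 1 / 4)
    (hc : 1 ≤ (α.filter (fun a => ¬ a < 1 / 2)).card) :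
    IT (fun t => dd (α : Set ℝ) (1 / 2 + t / 2)) ≤ 344 / 3577 / 4 := by
  refine (O.replR F {5 / 7} hgap ha (by simpa using hc)).trans ?_
  exact F.ubR1 ⟨5 / 7, by simp⟩ (by simp)

lemma corR2 (O : Opt IX IT Λ ρ α) (F : Fn IX IT)
    (hgap : ∀ a ∈ α, a ≤ 1 / 4 ∨ 1 / 2 ≤ a) (ha : ∃ a ∈ α, 0 ≤ a ∧ a ≤ 1 / 4)
    (hc : 2 ≤ (α.filter (fun a => ¬ a < 1 / 2)).card) :
    IT (fun t => dd (α : Set ℝ) (1 / 2 + t / 2)) ≤ 288 / 3577 / 128 + 344 / 3577 / 32 := by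
  refine (O.replR F {4 / 7, 6 / 7} hgap ha (Finset.card_le_two.trans hc)).trans ?_
  exact F.ubR2 ⟨4 / 7, by simp⟩ (by simp) (by simp)

end Opt

namespace Opt
variable {IX IT Λ : (ℝ → ℝ) → ℝ} {ρ : ℝ} {α : Finset ℝ}

lemma Hl (O : Opt IX IT Λ ρ α) {b : ℝ} (hb : b ∈ α) (h0 : 1 / 4 < b) (h1 : b < 1 / 2) (t : ℝ)
    (ht : t ≤ 1 / 4) (a : ℝ) (ha : a ∈ α) : t + b - 1 / 2 ≤ |t - a| := by
  rcases lt_or_ge a b with h | h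
  · have := O.g1l b hb h0 h1 a ha h
    exact le_abs.2 (Or.inl (by linarith))
  · exact le_abs.2 (Or.inr (by linarith))

lemma Hr (O : Opt IX IT Λ ρ α) {b : ℝ} (hb : b ∈ α) (h0 : 1 / 4 < b) (h1 : b < 1 / 2) (t : ℝ)
    (ht : 1 / 2 ≤ t) (a : ℝ) (ha : a ∈ α) : 1 - b - t ≤ |t - a| := by
  rcases le_or_gt a b with h | h
  · exact le_abs.2 (Or.inl (by linarith))
  · have := O.g1r b hb h0 h1 a ha h
    exact le_abs.2 (Or.inr (by linarith))

/-- lower bound for the left cell, split -/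
lemma Lsplit (O : Opt IX IT Λ ρ α) (F : Fn IX IT) :
    IX (fun x => dd (α : Set ℝ) (x / 4)) = 1 / 4 * IX (fun x => dd (α : Set ℝ) (x / 4 / 4))
      + 3 / 8 * IX (fun x => dd (α : Set ℝ) ((1 / 2 + x / 8) / 4))
      + 3 / 16 * IX (fun x => dd (α : Set ℝ) ((3 / 4 + x / 16) / 4))
      + 3 / 16 * IT (fun t => dd (α : Set ℝ) ((7 / 8 + t / 8) / 4)) :=
  F.X_split4 (fun x => dd (α : Set ℝ) (x / 4)) (Fn.cont_phi O.ne (by fun_prop))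

lemma Lbound (O : Opt IX IT Λ ρ α) (F : Fn IX IT) {b : ℝ} (hb : b ∈ α) (h0 : 1 / 4 < b)
    (h1 : b < 1 / 2) (c2 c3 c4 : ℝ) (hc2 : 0 ≤ c2) (hc3 : 0 ≤ c3) (hc4 : 0 ≤ c4) :
    3 / 8 * (2 * c2 * (b - 1 / 4 - 3 / 28) - c2 ^ 2) +
    3 / 16 * (2 * c3 * (b - 1 / 4 - 3 / 56) - c3 ^ 2) +
    3 / 16 * (2 * c4 * (b - 1 / 4 - 1 / 56) - c4 ^ 2) ≤ IX (fun x => dd (α : Set ℝ) (x / 4)) := by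
  rw [O.Lsplit F]
  have e1 := F.X_nonneg O.ne (φ := fun x => x / 4 / 4) (by fun_prop)
  have e2 := F.X_jen O.ne (φ := fun x => (1 / 2 + x / 8) / 4) (by fun_prop) (1 / 32) (b - 3 / 8) c2 hc2
    (fun x hx0 hx1 a ha => by
      have := O.Hl hb h0 h1 ((1 / 2 + x / 8) / 4) (by linarith) a ha; linarith)
  have e3 := F.X_jen O.ne (φ := fun x => (3 / 4 + x / 16) / 4) (by fun_prop) (1 / 64) (b - 5 / 16) c3 hc3
    (fun x hx0 hx1 a ha => by
      have := O.Hl hb h0 h1 ((3 / 4 + x / 16) / 4) (by linarith) a ha; linarith)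
  have e4 := F.T_jen O.ne (φ := fun x => (7 / 8 + x / 8) / 4) (by fun_prop) (1 / 32) (b - 9 / 32) c4 hc4
    (fun x hx0 hx1 a ha => by
      have := O.Hl hb h0 h1 ((7 / 8 + x / 8) / 4) (by linarith) a ha; linarith)
  linarith

lemma Fbound (O : Opt IX IT Λ ρ α) (F : Fn IX IT) {b : ℝ} (hb : b ∈ α) (h0 : 1 / 4 < b)
    (h1 : b < 1 / 2) :
    1 / 400 ≤ 1 / 2 * IX (fun x => dd (α : Set ℝ) (x / 4))
      + 1 / 4 * IX (fun x => dd (α : Set ℝ) (1 / 2 + x / 8)) := by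
  have hL := O.Lbound F hb h0 h1 0.0072 0.0607 0.0964 (by norm_num) (by norm_num) (by norm_num)
  have hs := F.X_split3 (fun x => dd (α : Set ℝ) (1 / 2 + x / 8)) (Fn.cont_phi O.ne (by fun_prop))
  have e2 := F.X_jen O.ne (φ := fun x => 1 / 2 + x / 4 / 8) (by fun_prop) (-1 / 32) (1 / 2 - b) 0.1178
    (by norm_num) (fun x hx0 hx1 a ha => by
      have := O.Hr hb h0 h1 (1 / 2 + x / 4 / 8) (by linarith) a ha; linarith)
  have e3 := F.X_jen O.ne (φ := fun x => 1 / 2 + (1 / 2 + x / 8) / 8) (by fun_prop) (-1 / 64) (7 / 16 - b)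
    0.0643 (by norm_num) (fun x hx0 hx1 a ha => by
      have := O.Hr hb h0 h1 (1 / 2 + (1 / 2 + x / 8) / 8) (by linarith) a ha; linarith)
  have e4 := F.T_jen O.ne (φ := fun x => 1 / 2 + (3 / 4 + x / 4) / 8) (by fun_prop) (-1 / 32) (13 / 32 - b)
    0.0286 (by norm_num) (fun x hx0 hx1 a ha => by
      have := O.Hr hb h0 h1 (1 / 2 + (3 / 4 + x / 4) / 8) (by linarith) a ha; linarith)
  rw [hs]
  norm_num at hL e2 e3 e4 ⊢
  linarith

/-- Claim A -/
lemma claimA (O : Opt IX IT Λ ρ α) (F : Fn IX IT) {r1 r2 : ℝ} (h1 : r1 ∈ α) (h2 : r2 ∈ α)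
    (hne : r1 ≠ r2) (h1' : 1 / 2 ≤ r1) (h2' : 1 / 2 ≤ r2) : ∃ a ∈ α, 0 ≤ a ∧ a ≤ 1 / 4 := by
  by_contra! hno
  have hsp := F.T_split3 _ (dd_cont α O.ne)
  have hT := F.T_nonneg O.ne (φ := fun x => 3 / 4 + x / 4) (by fun_prop)
  have hX2 := F.X_nonneg O.ne (φ := fun x => 1 / 2 + x / 8) (by fun_prop)
  have hL := O.Lsplit F
  have l1 := F.X_nonneg O.ne (φ := fun x => x / 4 / 4) (by fun_prop)
  have l2 := F.X_nonneg O.ne (φ := fun x => (1 / 2 + x / 8) / 4) (by fun_prop)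
  have l3 := F.X_nonneg O.ne (φ := fun x => (3 / 4 + x / 16) / 4) (by fun_prop)
  have l4 := F.T_nonneg O.ne (φ := fun x => (7 / 8 + x / 8) / 4) (by fun_prop)
  by_cases hb : ∃ b ∈ α, 1 / 4 < b ∧ b < 1 / 2
  · obtain ⟨b, hbα, hb0, hb1⟩ := hb
    have hc : 3 ≤ (α.filter (fun a => ¬ a < 0)).card :=
      Finset.two_lt_card.2 ⟨b, by simp [hbα]; linarith, r1, by simp [h1]; linarith, r2,
        by simp [h2]; linarith, by linarith, by linarith, hne⟩
    have c3 := O.cor3 F hc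
    have hneg : ∀ a ∈ α, a < b → a < 0 := fun a ha hab => by
      have e1 := O.g1l b hbα hb0 hb1 a ha hab
      by_contra h
      have := hno a ha (by linarith)
      linarith
    rcases le_or_gt (5 / 16) b with hb5 | hb5
    · have e2 := F.X_jen O.ne (φ := fun x => (1 / 2 + x / 8) / 4) (by fun_prop) (1 / 32) (1 / 8)
        (1 / 7) (by norm_num) (fun x hx0 hx1 a ha => by
          rcases lt_or_ge a b with h | h
          · have := hneg a ha h
            exact le_abs.2 (Or.inl (by linarith))
          · exact le_abs.2 (Or.inr (by linarith)))
      have e3 := F.X_jen O.ne (φ := fun x => (3 / 4 + x / 16) / 4) (by fun_prop) (-1 / 64) (1 / 8)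
        (13 / 112) (by norm_num) (fun x hx0 hx1 a ha => by
          rcases lt_or_ge a b with h | h
          · have := hneg a ha h
            exact le_abs.2 (Or.inl (by linarith))
          · exact le_abs.2 (Or.inr (by linarith)))
      have e4 := F.T_jen O.ne (φ := fun x => (7 / 8 + x / 8) / 4) (by fun_prop) (-1 / 32) (3 / 32)
        (9 / 112) (by norm_num) (fun x hx0 hx1 a ha => by
          rcases lt_or_ge a b with h | h
          · have := hneg a ha h
            exact le_abs.2 (Or.inl (by linarith))
          · exact le_abs.2 (Or.inr (by linarith)))
      norm_num at e2 e3 e4 c3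
      linarith
    · have e2 := F.X_jen O.ne (φ := fun x => (1 / 2 + x / 8) / 4) (by fun_prop) (-1 / 32) (1 / 8)
        (6 / 56) (by norm_num) (fun x hx0 hx1 a ha => by
          rcases lt_or_ge a b with h | h
          · have := hneg a ha h
            exact le_abs.2 (Or.inl (by linarith))
          · exact le_abs.2 (Or.inr (by linarith)))
      have e3 := F.X_jen O.ne (φ := fun x => 1 / 2 + x / 8) (by fun_prop) (-1 / 8) (3 / 16)
        (0.116) (by norm_num) (fun x hx0 hx1 a ha => by
          have := O.Hr hbα hb0 hb1 (1 / 2 + x / 8) (by linarith) a ha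
          linarith)
      norm_num at e2 e3 c3
      linarith
  · push Not at hb
    have hge : ∀ a ∈ α, 0 ≤ a → 1 / 2 ≤ a := fun a ha h => hb a ha (hno a ha h)
    have c2 := O.cor2 F (Finset.one_lt_card.2 ⟨r1, by simp [h1]; linarith, r2,
        by simp [h2]; linarith, hne⟩) (fun a ha h => by have := hge a ha h; linarith)
    have hsm : ∀ a ∈ α, a < 0 → a ≤ -1 / 32 := fun a ha h => by
      by_contra! hcon
      obtain ⟨a', ha', hlt, hle⟩ := O.lemL F (b0 := a) hcon.le
        (Finset.two_lt_card.2 ⟨a, by simp [ha], r1, by simp [h1]; linarith, r2,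
        by simp [h2]; linarith, by linarith, by linarith, hne⟩)
      have := O.g0 a ha (by linarith) h a' ha' hlt
      linarith
    have e1 := F.X_jen O.ne (φ := fun x => x / 4 / 4) (by fun_prop) (1 / 16) (1 / 32)
        (15 / 224) (by norm_num) (fun x hx0 hx1 a ha => by
          rcases lt_or_ge a 0 with h | h
          · have := hsm a ha h
            exact le_abs.2 (Or.inl (by linarith))
          · have := hge a ha h
            exact le_abs.2 (Or.inr (by linarith)))
    have e2 := F.X_jen O.ne (φ := fun x => (1 / 2 + x / 8) / 4) (by fun_prop) (1 / 32) (5 / 32)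
        (39 / 224) (by norm_num) (fun x hx0 hx1 a ha => by
          rcases lt_or_ge a 0 with h | h
          · have := hsm a ha h
            exact le_abs.2 (Or.inl (by linarith))
          · have := hge a ha h
            exact le_abs.2 (Or.inr (by linarith)))
    have e3 := F.X_jen O.ne (φ := fun x => (3 / 4 + x / 16) / 4) (by fun_prop) (1 / 64) (7 / 32)
        (51 / 224) (by norm_num) (fun x hx0 hx1 a ha => by
          rcases lt_or_ge a 0 with h | h
          · have := hsm a ha h
            exact le_abs.2 (Or.inl (by linarith))
          · have := hge a ha h
            exact le_abs.2 (Or.inr (by linarith)))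
    have e4 := F.T_jen O.ne (φ := fun x => (7 / 8 + x / 8) / 4) (by fun_prop) (0) (1 / 4)
        (1 / 4) (by norm_num) (fun x hx0 hx1 a ha => by
          rcases lt_or_ge a 0 with h | h
          · have := hsm a ha h
            exact le_abs.2 (Or.inl (by linarith))
          · have := hge a ha h
            exact le_abs.2 (Or.inr (by linarith)))
    norm_num at e1 e2 e3 e4 c2
    linarith
end Opt

namespace Opt
variable {IX IT Λ : (ℝ → ℝ) → ℝ} {ρ : ℝ} {α : Finset ℝ}

/-- Claim C: no points in the gap -/
lemma claimC (O : Opt IX IT Λ ρ α) (F : Fn IX IT) {a0 z : ℝ} (h1 : a0 ∈ α) (h2 : z ∈ α)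
    (hne : a0 ≠ z) (h0 : 0 ≤ a0) (h0' : a0 ≤ 1 / 4) (hz0 : 0 ≤ z) (hz : z ≤ 1 / 4 ∨ 1 / 2 ≤ z) :
    ∀ b ∈ α, b ≤ 1 / 4 ∨ 1 / 2 ≤ b := by
  intro b hbα
  by_contra! hb
  obtain ⟨hb0, hb1⟩ := hb
  have hzb : z ≠ b := by rintro rfl; rcases hz with h | h <;> linarith
  have hc3 : 3 ≤ (α.filter (fun a => ¬ a < 0)).card :=
    Finset.two_lt_card.2 ⟨a0, by simp [h1]; linarith, z, by simp [h2]; linarith, b,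
      by simp [hbα]; linarith, hne, by linarith, hzb⟩
  have c3 := O.cor3 F hc3
  have hsp := F.T_split3 _ (dd_cont α O.ne)
  have hT := F.T_nonneg O.ne (φ := fun x => 3 / 4 + x / 4) (by fun_prop)
  have hX2 := F.X_nonneg O.ne (φ := fun x => 1 / 2 + x / 8) (by fun_prop)
  have hX1 := F.X_nonneg O.ne (φ := fun x => x / 4) (by fun_prop)
  have hF := O.Fbound F hbα hb0 hb1
  by_cases hR : ∃ b1 ∈ α, 1 / 2 ≤ b1
  swap
  · push Not at hR
    have e := F.T_jen O.ne (φ := fun x => 3 / 4 + x / 4) (by fun_prop) 0 (1 / 4) (1 / 4) (by norm_num)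
      (fun x hx0 hx1 a ha => by
        have := hR a ha
        exact le_abs.2 (Or.inl (by linarith)))
    norm_num at e c3
    linarith
  obtain ⟨b1, hb1α, hb1h⟩ := hR
  by_cases h4 : ∀ a ∈ α, 0 ≤ a → a = a0 ∨ a = b ∨ a = b1
  swap
  · push Not at h4
    obtain ⟨a, ha, ha0, ne1, ne2, ne3⟩ := h4
    have hc4 : 4 ≤ (α.filter (fun a => ¬ a < 0)).card := by
      have hc : ({a, a0, b, b1} : Finset ℝ).card = 4 := by
        have n1 : a0 ≠ b := by linarith
        have n2 : a0 ≠ b1 := by linarith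
        have n3 : b ≠ b1 := by linarith
        simp [ne1, ne2, ne3, n1, n2, n3]
      rw [← hc]
      refine Finset.card_le_card fun x hx => ?_
      simp only [Finset.mem_insert, Finset.mem_singleton] at hx
      rcases hx with rfl | rfl | rfl | rfl
      · exact Finset.mem_filter.2 ⟨ha, by linarith⟩
      · exact Finset.mem_filter.2 ⟨h1, by linarith⟩
      · exact Finset.mem_filter.2 ⟨hbα, by linarith⟩
      · exact Finset.mem_filter.2 ⟨hb1α, by linarith⟩
    have c4 := O.cor4 F hc4
    norm_num at c4
    linarith
  have hle : ∀ a ∈ α, a ≤ b ∨ a = b1 := fun a ha => by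
    rcases lt_or_ge a 0 with h | h
    · exact Or.inl (by linarith)
    · rcases h4 a ha h with h | h | h
      · exact Or.inl (by linarith)
      · exact Or.inl (by linarith)
      · exact Or.inr h
  rcases le_or_gt b1 0.81 with hb8 | hb8
  · have e := F.T_sq O.ne (φ := fun x => 3 / 4 + x / 4) (by fun_prop) (1 / 4) (3 / 4 - b1)
      (fun x hx0 hx1 a ha => by
        rcases hle a ha with h | h
        · refine le_trans (abs_le.2 ⟨?_, ?_⟩) (le_abs_self _)
          · norm_num at hb8 ⊢; linarith
          · linarith
        · rw [h]; exact le_of_eq (by congr 1; ring))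
    norm_num at e c3 hb8
    nlinarith [sq_nonneg (81 / 100 - b1)]
  rcases le_or_gt 0.44 b with hb4 | hb4
  · have e := O.Lbound F hbα hb0 hb1 0.0829 0.1364 0.1721 (by norm_num) (by norm_num) (by norm_num)
    norm_num at e c3 hb4
    linarith
  · norm_num at hb4 hb8
    have e := F.X_sq O.ne (φ := fun x => 1 / 2 + x / 8) (by fun_prop) (1 / 8) 0.06
      (fun x hx0 hx1 a ha => by
        rw [abs_of_nonneg (by norm_num; linarith)]
        norm_num
        rcases hle a ha with h | h
        · exact le_abs.2 (Or.inl (by linarith))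
        · exact le_abs.2 (Or.inr (by linarith)))
    norm_num at e c3
    linarith

lemma lemE1 (O : Opt IX IT Λ ρ α) (F : Fn IX IT)
    (hgap : ∀ a ∈ α, a ≤ 1 / 4 ∨ 1 / 2 ≤ a) (ha : ∃ a ∈ α, 0 ≤ a ∧ a ≤ 1 / 4)
    {r : ℝ} (hr : r ∈ α) (hr2 : 1 / 2 ≤ r) : ∃ c ∈ α, 1 / 2 ≤ c ∧ c < 3 / 4 := by
  by_contra! hno
  have hg : ∀ a ∈ α, a ≤ 1 / 4 ∨ 3 / 4 ≤ a := fun a ha => (hgap a ha).imp_right (hno a ha)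
  have hr3 := hno r hr hr2
  have hs := F.R_split _ (dd_cont α O.ne)
  have hT := F.T_nonneg O.ne (φ := fun x => 3 / 4 + x / 4) (by fun_prop)
  by_cases h2 : ∃ r' ∈ α, 1 / 2 ≤ r' ∧ r' ≠ r
  · obtain ⟨r', hr', hr2', hne⟩ := h2
    have c2 := O.corR2 F hgap ha (Finset.one_lt_card.2 ⟨r', by simp [hr']; linarith, r,
      by simp [hr]; linarith, hne⟩)
    have e := F.X_jen O.ne (φ := fun x => 1 / 2 + x / 8) (by fun_prop) (-1 / 8) (1 / 4) (5 / 28)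
      (by norm_num) (fun x hx0 hx1 a ha => by
        rcases hg a ha with h | h
        · exact le_abs.2 (Or.inl (by linarith))
        · exact le_abs.2 (Or.inr (by linarith)))
    norm_num at e c2
    linarith
  push Not at h2
  have hg' : ∀ a ∈ α, a ≤ 1 / 4 ∨ a = r := fun a ha => (hgap a ha).imp_right (h2 a ha)
  have c1 := O.corR1 F hgap ha (Finset.card_pos.2 ⟨r, by simp [hr]; linarith⟩)
  rcases le_or_gt (7 / 8) r with hr7 | hr7
  · have e := F.X_jen O.ne (φ := fun x => 1 / 2 + x / 8) (by fun_prop) 0 (1 / 4) (1 / 4)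
      (by norm_num) (fun x hx0 hx1 a ha => by
        rcases hg' a ha with h | h
        · exact le_abs.2 (Or.inl (by linarith))
        · exact le_abs.2 (Or.inr (by linarith)))
    norm_num at e c1
    linarith
  · have hs2 := F.X_split (fun x => dd (α : Set ℝ) (1 / 2 + x / 8)) (Fn.cont_phi O.ne (by fun_prop))
    have e1 := F.X_jen O.ne (φ := fun x => 1 / 2 + x / 4 / 8) (by fun_prop) (-1 / 32) (1 / 4) (13 / 56)
      (by norm_num) (fun x hx0 hx1 a ha => by
        rcases hg' a ha with h | h
        · exact le_abs.2 (Or.inl (by linarith))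
        · exact le_abs.2 (Or.inr (by linarith)))
    have e2 := F.T_jen O.ne (φ := fun x => 1 / 2 + (1 / 2 + x / 2) / 8) (by fun_prop) (-1 / 16)
      (r - 9 / 16) (9 / 56)
      (by norm_num) (fun x hx0 hx1 a ha => by
        rcases hg' a ha with h | h
        · exact le_abs.2 (Or.inl (by linarith))
        · exact le_abs.2 (Or.inr (by linarith)))
    have e3 := F.T_sq O.ne (φ := fun x => 3 / 4 + x / 4) (by fun_prop) (1 / 4) (3 / 4 - r)
      (fun x hx0 hx1 a ha => by
        rcases hg' a ha with h | h
        · refine le_trans (abs_le.2 ⟨?_, ?_⟩) (le_abs_self _)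
          · linarith
          · linarith
        · rw [h]; exact le_of_eq (by congr 1; ring))
    norm_num at e1 e2 e3 c1
    nlinarith [sq_nonneg (3 / 4 - r)]

/-- Claim D -/
lemma claimD (O : Opt IX IT Λ ρ α) (F : Fn IX IT)
    (hgap : ∀ a ∈ α, a ≤ 1 / 4 ∨ 1 / 2 ≤ a) {p0 p1 : ℝ} (h0 : p0 ∈ α) (h1 : p1 ∈ α)
    (h00 : 0 ≤ p0) (hlt : p0 < p1) (h11 : p1 ≤ 1 / 4) : ∃ c ∈ α, 1 / 2 ≤ c ∧ c ≤ 5 / 8 := by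
  by_contra! hno
  have ha : ∃ a ∈ α, 0 ≤ a ∧ a ≤ 1 / 4 := ⟨p0, h0, h00, by linarith⟩
  by_cases hR : ∃ r ∈ α, 1 / 2 ≤ r
  · obtain ⟨r, hr, hr2⟩ := hR
    obtain ⟨c, hc, hc1, hc2⟩ := O.lemE1 F hgap ha hr hr2
    have hc3 := hno c hc hc1
    have hlc : ∀ a ∈ α, a < c → a ≤ 1 / 4 := fun a ha hac => by
      have e := O.g2l c hc hc3 hc2 a ha hac
      rcases hgap a ha with h | h
      · exact h
      · have := hno a ha h
        linarith
    by_cases h : ∃ c' ∈ α, c < c'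
    · obtain ⟨c', hc', hcc⟩ := h
      have c2 := O.corR2 F hgap ha (Finset.one_lt_card.2 ⟨c, by simp [hc]; linarith, c',
        by simp [hc']; linarith, by linarith⟩)
      have hs := F.R_split _ (dd_cont α O.ne)
      have hs2 := F.R2_split _ (dd_cont α O.ne)
      have hT := F.T_nonneg O.ne (φ := fun x => 7 / 8 + x / 8) (by fun_prop)
      have e1 := F.X_sq O.ne (φ := fun x => 1 / 2 + x / 8) (by fun_prop) (-1 / 8) (c - 1 / 2)
        (fun x hx0 hx1 a ha => by
          rw [abs_of_nonneg (by linarith)]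
          rcases lt_or_ge a c with h | h
          · have := hlc a ha h
            exact le_abs.2 (Or.inl (by linarith))
          · exact le_abs.2 (Or.inr (by linarith)))
      have e2 := F.X_jen O.ne (φ := fun x => 3 / 4 + x / 16) (by fun_prop) (-1 / 16) (3 / 4 - c)
        (5 / 56) (by norm_num)
        (fun x hx0 hx1 a ha => by
          rcases le_or_gt a c with h | h
          · exact le_abs.2 (Or.inl (by linarith))
          · have := O.g2r c hc hc3 hc2 a ha h
            exact le_abs.2 (Or.inr (by linarith)))
      norm_num at e1 e2 c2
      nlinarith [sq_nonneg (c - 5 / 8)]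
    · push Not at h
      have c3 := O.cor3 F (Finset.two_lt_card.2 ⟨p0, by simp [h0]; linarith, p1,
        by simp [h1]; linarith, c, by simp [hc]; linarith, by linarith, by linarith, by linarith⟩)
      have hsp := F.T_split3 _ (dd_cont α O.ne)
      have hX2 := F.X_nonneg O.ne (φ := fun x => 1 / 2 + x / 8) (by fun_prop)
      have hX1 := F.X_nonneg O.ne (φ := fun x => x / 4) (by fun_prop)
      have e := F.T_sq O.ne (φ := fun x => 3 / 4 + x / 4) (by fun_prop) (1 / 4) 0
        (fun x hx0 hx1 a ha => by
          rw [abs_of_nonneg (by linarith)]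
          have := h a ha
          exact le_abs.2 (Or.inl (by linarith)))
      norm_num at e c3
      linarith
  · push Not at hR
    have hg : ∀ a ∈ α, a ≤ 1 / 4 := fun a ha => (hgap a ha).resolve_right (not_le.2 (hR a ha))
    have m0 : p0 ∈ insert (5 / 7) (α.erase p1) := by simp [h0]; right; linarith
    have m1 : (5 / 7 : ℝ) ∈ insert (5 / 7) (α.erase p1) := by simp
    have hβ : (insert (5 / 7) (α.erase p1)).Nonempty := ⟨_, m0⟩
    have hc : (insert (5 / 7) (α.erase p1)).card ≤ α.card := by
      have e1 := Finset.card_insert_le (5 / 7 : ℝ) (α.erase p1)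
      have e2 := Finset.card_erase_add_one h1
      omega
    have key := O.cmpT F _ hβ hc (fun t ht => dd_mono (by exact_mod_cast O.ne) fun a ha => by
      by_cases hap : a = p1
      · exact ⟨p0, by exact_mod_cast m0, by rw [hap]; exact abs_aux1 (by linarith) hlt.le⟩
      · exact ⟨a, by simp at ha ⊢; tauto, le_rfl⟩)
    rw [F.T_split _ (dd_cont α O.ne), F.T_split _ (dd_cont _ hβ)] at key
    have u1 := F.ubR1 hβ m1
    have u2 := F.X_ub hβ m0 0 (1 / 4)
    have e1 : (fun x : ℝ => dd ((insert (5 / 7) (α.erase p1) : Finset ℝ) : Set ℝ) (0 + x * (1 / 4)))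
        = fun x => dd ((insert (5 / 7) (α.erase p1) : Finset ℝ) : Set ℝ) (x / 4) := by
      funext x; congr 1; ring
    rw [e1] at u2
    have hX1 := F.X_nonneg O.ne (φ := fun x => x / 4) (by fun_prop)
    have l := F.T_jen O.ne (φ := fun x => 1 / 2 + x / 2) (by fun_prop) (1 / 2) (1 / 4) (13 / 28)
      (by norm_num)
      (fun x hx0 hx1 a ha => by
        have := hg a ha
        exact le_abs.2 (Or.inl (by linarith)))
    norm_num at l
    have q : p0 ^ 2 ≤ p0 / 4 := by nlinarith
    linarith

lemma lemE2 (O : Opt IX IT Λ ρ α) (F : Fn IX IT)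
    (hgap : ∀ a ∈ α, a ≤ 1 / 4 ∨ 1 / 2 ≤ a) (ha : ∃ a ∈ α, 0 ≤ a ∧ a ≤ 1 / 4)
    {r : ℝ} (hr : r ∈ α) (hr2 : 1 / 2 ≤ r) : ∃ a ∈ α, 0 ≤ a ∧ a ≤ 1 / 4 ∧ 1 / 2 < a + r := by
  by_contra! hno
  have hz : ∀ a ∈ α, a ≤ 0 ∨ 1 / 2 ≤ a := fun a ha => by
    rcases hgap a ha with h | h
    · left
      by_contra! h'
      have := hno a ha h'.le h
      linarith
    · exact Or.inr h
  obtain ⟨a0, ha0, ha00, ha01⟩ := id ha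
  have hle := hno a0 ha0 ha00 ha01
  have hrr : r = 1 / 2 := by linarith
  by_cases h2 : ∃ r' ∈ α, 1 / 2 ≤ r' ∧ r' ≠ r
  · obtain ⟨r', hr', hr2', hne⟩ := h2
    have c3 := O.cor3 F (Finset.two_lt_card.2 ⟨a0, by simp [ha0]; linarith, r',
        by simp [hr']; linarith, r, by simp [hr]; linarith, by linarith, by linarith, hne⟩)
    have hsp := F.T_split3 _ (dd_cont α O.ne)
    have hX2 := F.X_nonneg O.ne (φ := fun x => 1 / 2 + x / 8) (by fun_prop)
    have hT := F.T_nonneg O.ne (φ := fun x => 3 / 4 + x / 4) (by fun_prop)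
    have e := F.X_sq O.ne (φ := fun x => x / 4) (by fun_prop) (1 / 4) 0
        (fun x hx0 hx1 a ha => by
          rw [abs_of_nonneg (by linarith)]
          rcases hz a ha with h | h
          · exact le_abs.2 (Or.inl (by linarith))
          · exact le_abs.2 (Or.inr (by linarith)))
    norm_num at e c3
    linarith
  · push Not at h2
    have c1 := O.corR1 F hgap ha (Finset.card_pos.2 ⟨r, by simp [hr]; linarith⟩)
    have e := F.T_sq O.ne (φ := fun x => 1 / 2 + x / 2) (by fun_prop) (1 / 2) 0
        (fun x hx0 hx1 a ha => by
          rw [abs_of_nonneg (by linarith)]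
          rcases hz a ha with h | h
          · exact le_abs.2 (Or.inl (by linarith))
          · have := h2 a ha h
            exact le_abs.2 (Or.inl (by linarith)))
    norm_num at e c1
    linarith

end Opt

/-! ## The measure part -/

lemma S_eq (i : ℕ) (x : ℝ) : S (i + 1) x = 1 - (1 / 2) ^ i * (1 - x / 4) := by
  have h : ((1 : ℝ) / 2) ^ i = 1 / 2 ^ i := by rw [div_pow, one_pow]
  simp only [S, Nat.add_sub_cancel]
  rw [h, pow_add, pow_add]; field_simp; ring

lemma S_cont (i : ℕ) : Continuous (S (i + 1)) := by
  have : S (i + 1) = fun x => 1 - (1 / 2) ^ i * (1 - x / 4) := funext (S_eq i)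
  rw [this]; fun_prop

lemma S_zero (x : ℝ) : S (0 + 1) x = x / 4 := by rw [S_eq]; ring

lemma S_succ (i : ℕ) (x : ℝ) : S (i + 1 + 1) x = 1 / 2 + S (i + 1) x / 2 := by
  rw [S_eq, S_eq, pow_succ]; ring

lemma pow_half_mem (i : ℕ) : 0 < ((1 : ℝ) / 2) ^ i ∧ ((1 : ℝ) / 2) ^ i ≤ 1 :=
  ⟨by positivity, pow_le_one₀ (by norm_num) (by norm_num)⟩

lemma S_mem (i : ℕ) {x : ℝ} (h0 : 0 ≤ x) (h1 : x ≤ 1) : 0 ≤ S (i + 1) x ∧ S (i + 1) x ≤ 1 := by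
  rw [S_eq]
  obtain ⟨a, b⟩ := pow_half_mem i
  constructor <;> nlinarith

lemma p_pos (i : ℕ) : 0 < p (i + 1) := by
  unfold p; split_ifs <;> positivity

lemma p_zero : p (0 + 1) = 1 / 4 := by simp [p]

lemma p_succ (i : ℕ) : p (i + 1 + 1) = 3 / 4 * (1 / 2) ^ (i + 1) := by
  have : i + 1 + 1 ≠ 1 := by omega
  rw [p, if_neg this, div_pow, one_pow, pow_add _ (i + 1 + 1) 1, pow_add _ (i + 1) 1]
  field_simp; norm_num

section meas
variable (P : Measure ℝ)

def IX (g : ℝ → ℝ) : ℝ := ∫ x, g x ∂P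

def IT (g : ℝ → ℝ) : ℝ := ∑' j : ℕ, (1 / 2) ^ (j + 1) * IX P (fun x => g (S (j + 1) x))

variable {P} [IsProbabilityMeasure P]

lemma ae_mem (hsupp : P (Set.Icc 0 1) = 1) : ∀ᵐ x ∂P, x ∈ Set.Icc (0 : ℝ) 1 := by
  rw [← prob_compl_eq_zero_iff measurableSet_Icc] at hsupp
  exact hsupp

lemma integ (hsupp : P (Set.Icc 0 1) = 1) {g : ℝ → ℝ} (hg : Continuous g) : Integrable g P := by
  rw [← Measure.restrict_eq_self_of_ae_mem (ae_mem hsupp)]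
  exact hg.continuousOn.integrableOn_compact isCompact_Icc

lemma IX_mono (hsupp : P (Set.Icc 0 1) = 1) (g h : ℝ → ℝ) (hg : Continuous g) (hh : Continuous h)
    (H : ∀ x, 0 ≤ x → x ≤ 1 → g x ≤ h x) : IX P g ≤ IX P h := by
  refine integral_mono_ae (integ hsupp hg) (integ hsupp hh) ?_
  filter_upwards [ae_mem hsupp] with x hx using H x hx.1 hx.2

lemma meas_eq (hinv : Invariant P) :
    P = Measure.sum (fun j : ℕ => ENNReal.ofReal (p (j + 1)) • P.map (S (j + 1))) := by
  ext A hA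
  rw [Measure.sum_apply _ hA, hinv A hA]
  congr 1; funext j
  rw [Measure.smul_apply, Measure.map_apply (S_cont j).measurable hA, smul_eq_mul]

lemma IX_hasSum (hsupp : P (Set.Icc 0 1) = 1) (hinv : Invariant P) {g : ℝ → ℝ} (hg : Continuous g) :
    HasSum (fun j : ℕ => p (j + 1) * IX P (fun x => g (S (j + 1) x))) (IX P g) := by
  have h1 : Integrable g (Measure.sum (fun j : ℕ => ENNReal.ofReal (p (j + 1)) • P.map (S (j + 1)))) := by
    rw [← meas_eq hinv]; exact integ hsupp hg
  have h2 := hasSum_integral_measure h1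
  rw [← meas_eq hinv] at h2
  have e : ∀ j : ℕ, p (j + 1) * IX P (fun x => g (S (j + 1) x)) =
      ∫ x, g x ∂(ENNReal.ofReal (p (j + 1)) • P.map (S (j + 1))) := fun j => ?_
  · simp only [e]; exact h2
  rw [integral_smul_measure, integral_map (S_cont j).aemeasurable hg.aestronglyMeasurable,
    ENNReal.toReal_ofReal (p_pos j).le, smul_eq_mul, IX]

lemma IX_bdd (hsupp : P (Set.Icc 0 1) = 1) {g : ℝ → ℝ} (hg : Continuous g) :
    ∃ M, ∀ φ : ℝ → ℝ, Continuous φ → (∀ x, 0 ≤ x → x ≤ 1 → 0 ≤ φ x ∧ φ x ≤ 1) →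
      |IX P (fun x => g (φ x))| ≤ M := by
  obtain ⟨M, hM⟩ := (isCompact_Icc (a := (0 : ℝ)) (b := 1)).exists_bound_of_continuousOn hg.continuousOn
  refine ⟨M, fun φ hφ h => ?_⟩
  have e1 := IX_mono hsupp (fun x => g (φ x)) (fun _ => M) (by fun_prop) (by fun_prop)
    (fun x h0 h1 => (abs_le.1 (hM (φ x) ⟨(h x h0 h1).1, (h x h0 h1).2⟩)).2)
  have e2 := IX_mono hsupp (fun _ => -M) (fun x => g (φ x)) (by fun_prop) (by fun_prop)
    (fun x h0 h1 => (abs_le.1 (hM (φ x) ⟨(h x h0 h1).1, (h x h0 h1).2⟩)).1)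
  simp only [IX, integral_const, probReal_univ, smul_eq_mul, one_mul] at e1 e2
  exact abs_le.2 ⟨by simpa [IX] using e2, by simpa [IX] using e1⟩

lemma IT_summable (hsupp : P (Set.Icc 0 1) = 1) {g : ℝ → ℝ} (hg : Continuous g) :
    Summable (fun j : ℕ => (1 / 2 : ℝ) ^ (j + 1) * IX P (fun x => g (S (j + 1) x))) := by
  obtain ⟨M, hM⟩ := IX_bdd hsupp hg
  have : Summable (fun j : ℕ => (1 / 2 : ℝ) ^ (j + 1) * M) :=
    ((summable_nat_add_iff 1).2 summable_geometric_two).mul_right M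
  refine Summable.of_norm_bounded this fun j => ?_
  rw [norm_mul, Real.norm_of_nonneg (by positivity)]
  exact mul_le_mul_of_nonneg_left (hM _ (S_cont j) fun x h0 h1 => S_mem j h0 h1) (by positivity)

lemma IT_split (hsupp : P (Set.Icc 0 1) = 1) {g : ℝ → ℝ} (hg : Continuous g) :
    IT P g = 1 / 2 * IX P (fun x => g (x / 4)) + 1 / 2 * IT P (fun t => g (1 / 2 + t / 2)) := by
  rw [IT, (IT_summable hsupp hg).tsum_eq_zero_add]
  congr 1
  · simp only [S_zero]; norm_num
  · rw [IT, ← tsum_mul_left]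
    congr 1; funext j
    simp only [S_succ]; rw [pow_succ]; ring

lemma IX_split (hsupp : P (Set.Icc 0 1) = 1) (hinv : Invariant P) {g : ℝ → ℝ} (hg : Continuous g) :
    IX P g = 1 / 4 * IX P (fun x => g (x / 4)) + 3 / 4 * IT P (fun t => g (1 / 2 + t / 2)) := by
  rw [← (IX_hasSum hsupp hinv hg).tsum_eq, (IX_hasSum hsupp hinv hg).summable.tsum_eq_zero_add]
  congr 1
  · simp only [S_zero, p_zero]
  · rw [IT, ← tsum_mul_left]
    congr 1; funext j
    simp only [S_succ, p_succ]; ring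

lemma IT_mono (hsupp : P (Set.Icc 0 1) = 1) (g h : ℝ → ℝ) (hg : Continuous g) (hh : Continuous h)
    (H : ∀ x, 0 ≤ x → x ≤ 1 → g x ≤ h x) : IT P g ≤ IT P h := by
  refine (IT_summable hsupp hg).tsum_le_tsum (fun j => ?_) (IT_summable hsupp hh)
  have := S_cont j
  refine mul_le_mul_of_nonneg_left (IX_mono hsupp _ _ (by fun_prop) (by fun_prop) fun x h0 h1 => ?_)
    (by positivity)
  exact H _ (S_mem j h0 h1).1 (S_mem j h0 h1).2

lemma IX_lin (hsupp : P (Set.Icc 0 1) = 1) (A B C : ℝ) {f g : ℝ → ℝ} (hf : Continuous f)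
    (hg : Continuous g) : IX P (fun x => A + B * f x + C * g x) = A + B * IX P f + C * IX P g := by
  have h1 := (integ hsupp hf).const_mul B
  have h2 := (integ hsupp hg).const_mul C
  have h3 : Integrable (fun x => A + B * f x) P := (integrable_const A).add h1
  unfold IX
  rw [← integral_const_mul B, ← integral_const_mul C]
  have e1 := integral_add h3 h2
  have e2 := integral_add (integrable_const (μ := P) A) h1
  simp only [integral_const, probReal_univ, smul_eq_mul, one_mul] at e1 e2
  rw [← e2, ← e1]

lemma IT_lin (hsupp : P (Set.Icc 0 1) = 1) (A B C : ℝ) {f g : ℝ → ℝ} (hf : Continuous f)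
    (hg : Continuous g) : IT P (fun x => A + B * f x + C * g x) = A + B * IT P f + C * IT P g := by
  have h1 := (IT_summable hsupp hf).hasSum.mul_left B
  have h2 := (IT_summable hsupp hg).hasSum.mul_left C
  have h0 : HasSum (fun j : ℕ => (1 / 2 : ℝ) ^ (j + 1) * A) A := by
    have := (hasSum_geometric_two' 1).mul_right A
    have e : ∀ j : ℕ, (1 / 2 : ℝ) ^ (j + 1) * A = 1 / 2 / 2 ^ j * A := fun j => by
      rw [pow_succ, div_pow, one_pow]; ring
    simp only [e]
    simpa using this
  refine HasSum.tsum_eq ?_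
  have e : ∀ j : ℕ, (1 / 2 : ℝ) ^ (j + 1) * IX P (fun x => A + B * f (S (j + 1) x) + C * g (S (j + 1) x))
      = (1 / 2) ^ (j + 1) * A + B * ((1 / 2) ^ (j + 1) * IX P fun x => f (S (j + 1) x))
        + C * ((1 / 2) ^ (j + 1) * IX P fun x => g (S (j + 1) x)) := fun j => ?_
  · simp only [e]; exact (h0.add h1).add h2
  have := S_cont j
  rw [IX_lin hsupp A B C (f := fun x => f (S (j + 1) x)) (g := fun x => g (S (j + 1) x))
    (by fun_prop) (by fun_prop)]
  ring

theorem fn (hsupp : P (Set.Icc 0 1) = 1) (hinv : Invariant P) : Fn (IX P) (IT P) := by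
  have cid : Continuous (fun x : ℝ => x) := by fun_prop
  have csq : Continuous (fun x : ℝ => x ^ 2) := by fun_prop
  have a1 := IX_split hsupp hinv cid
  have a2 := IX_split hsupp hinv csq
  have b1 := IT_split hsupp cid
  have b2 := IT_split hsupp csq
  have e1 : (fun x : ℝ => x / 4) = fun x => 0 + 1 / 4 * x + 0 * x ^ 2 := by funext x; ring
  have e2 : (fun x : ℝ => (x / 4) ^ 2) = fun x => 0 + 0 * x + 1 / 16 * x ^ 2 := by funext x; ring
  have e3 : (fun x : ℝ => 1 / 2 + x / 2) = fun x => 1 / 2 + 1 / 2 * x + 0 * x ^ 2 := by funext x; ring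
  have e4 : (fun x : ℝ => (1 / 2 + x / 2) ^ 2) = fun x => 1 / 4 + 1 / 2 * x + 1 / 4 * x ^ 2 := by
    funext x; ring
  rw [e1, e3, IX_lin hsupp _ _ _ cid csq, IT_lin hsupp _ _ _ cid csq] at a1 b1
  rw [e2, e4, IX_lin hsupp _ _ _ cid csq, IT_lin hsupp _ _ _ cid csq] at a2 b2
  have m1 : IX P (fun x => x) = 4 / 7 := by linarith
  have t1 : IT P (fun x => x) = 3 / 7 := by linarith
  have m2 : IX P (fun x => x ^ 2) = 208 / 511 := by linarith
  have t2 : IT P (fun x => x ^ 2) = 143 / 511 := by linarith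
  exact {
    X_split := fun g hg => IX_split hsupp hinv hg
    T_split := fun g hg => IT_split hsupp hg
    X_mono := IX_mono hsupp
    T_mono := IT_mono hsupp
    X_quad := fun A B C => by rw [IX_lin hsupp _ _ _ cid csq, m1, m2]
    T_quad := fun A B C => by rw [IT_lin hsupp _ _ _ cid csq, t1, t2] }

/-- decomposition of the integral at level `k` -/
lemma IX_decomp (hsupp : P (Set.Icc 0 1) = 1) (hinv : Invariant P) (k : ℕ) {g : ℝ → ℝ}
    (hg : Continuous g) :
    IX P g = (∑ j ∈ Finset.range k, p (j + 1) * IX P (fun x => g (S (j + 1) x)))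
      + p (k + 1) * IX P (fun x => g (S (k + 1) x))
      + 3 / 4 * (1 / 2) ^ k * IT P (fun t => g (1 - (1 / 2) ^ (k + 1) * (1 - t))) := by
  have h := IX_hasSum hsupp hinv hg
  rw [← h.tsum_eq, ← h.summable.sum_add_tsum_nat_add (k + 1), Finset.sum_range_succ]
  congr 1
  rw [IT, ← tsum_mul_left]
  congr 1; funext j
  have e : ∀ x, S (j + (k + 1) + 1) x = 1 - (1 / 2) ^ (k + 1) * (1 - S (j + 1) x) := fun x => by
    rw [S_eq, S_eq, pow_add _ j]; ring
  simp only [e]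
  rw [show j + (k + 1) + 1 = (j + k) + 1 + 1 by ring, p_succ]
  rw [← mul_assoc]; congr 1; ring

end meas

section gaps
variable {P : Measure ℝ} [IsProbabilityMeasure P]

lemma IX_nn (hsupp : P (Set.Icc 0 1) = 1) {f : ℝ → ℝ} (hf : Continuous f)
    (h : ∀ x, 0 ≤ x → x ≤ 1 → 0 ≤ f x) : 0 ≤ IX P f := by
  have := IX_mono hsupp (fun _ => 0) f (by fun_prop) hf h
  simpa [IX] using this

lemma IX_term (hsupp : P (Set.Icc 0 1) = 1) (hinv : Invariant P) {f : ℝ → ℝ} (hf : Continuous f)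
    (h : ∀ x, 0 ≤ x → x ≤ 1 → 0 ≤ f x) (j : ℕ) :
    p (j + 1) * IX P (fun x => f (S (j + 1) x)) ≤ IX P f := by
  refine le_hasSum (IX_hasSum hsupp hinv hf) j fun i _ => mul_nonneg (p_pos i).le ?_
  have := S_cont i
  exact IX_nn hsupp (by fun_prop) fun x h0 h1 => h _ (S_mem i h0 h1).1 (S_mem i h0 h1).2

lemma IX_iter (hsupp : P (Set.Icc 0 1) = 1) (hinv : Invariant P) (n : ℕ) : ∀ {f : ℝ → ℝ},
    Continuous f → (∀ x, 0 ≤ x → x ≤ 1 → 0 ≤ f x) →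
    (1 / 4) ^ n * IX P (fun x => f (x * (1 / 4) ^ n)) ≤ IX P f := by
  induction n with
  | zero => intro f hf h; simp
  | succ n ih =>
    intro f hf h
    have e1 := IX_term hsupp hinv hf h 0
    simp only [S_zero, p_zero] at e1
    have e2 := ih (f := fun x => f (x / 4)) (by fun_prop) (fun x h0 h1 => h _ (by linarith) (by linarith))
    have e3 : (fun x : ℝ => f (x * (1 / 4) ^ (n + 1))) = fun x => f (x * (1 / 4) ^ n / 4) := by
      funext x; congr 1; ring
    rw [e3, pow_succ]
    linarith

lemma IX_pos (hsupp : P (Set.Icc 0 1) = 1) (hinv : Invariant P) {f : ℝ → ℝ} (hf : Continuous f)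
    (h : ∀ x, 0 ≤ x → x ≤ 1 → 0 ≤ f x) {ε : ℝ} (hε : ε = 0 ∨ ε = 1) (h0 : 0 < f ε) : 0 < IX P f := by
  obtain ⟨δ, hδ, H⟩ := Metric.continuous_iff.1 hf ε (f ε / 2) (by linarith)
  have H' : ∀ x, |x - ε| < δ → f ε / 2 ≤ f x := fun x hx => by
    have := H x (by rwa [Real.dist_eq])
    rw [Real.dist_eq] at this
    have := (abs_lt.1 this).1
    linarith
  rcases hε with rfl | rfl
  · obtain ⟨n, hn⟩ := exists_pow_lt_of_lt_one hδ (show (1 / 4 : ℝ) < 1 by norm_num)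
    have e1 := IX_iter hsupp hinv n hf h
    have e2 := IX_mono hsupp (fun _ => f 0 / 2) (fun x => f (x * (1 / 4) ^ n)) (by fun_prop) (by fun_prop)
      (fun x h0 h1 => H' _ (by
        have : (0 : ℝ) < (1 / 4) ^ n := by positivity
        rw [sub_zero, abs_of_nonneg (by positivity)]; nlinarith))
    have e3 : IX P (fun _ => f 0 / 2) = f 0 / 2 := by simp [IX]
    refine lt_of_lt_of_le ?_ e1
    rw [e3] at e2
    have : 0 < IX P (fun x => f (x * (1 / 4) ^ n)) := by linarith
    positivity
  · obtain ⟨n, hn⟩ := exists_pow_lt_of_lt_one hδ (show (1 / 2 : ℝ) < 1 by norm_num)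
    have e1 := IX_term hsupp hinv hf h n
    have := S_cont n
    have e2 := IX_mono hsupp (fun _ => f 1 / 2) (fun x => f (S (n + 1) x)) (by fun_prop) (by fun_prop)
      (fun x h0 h1 => H' _ (by
        have := (pow_half_mem n).1
        rw [S_eq, abs_lt]; constructor <;> nlinarith))
    have e3 : IX P (fun _ => f 1 / 2) = f 1 / 2 := by simp [IX]
    refine lt_of_lt_of_le ?_ e1
    rw [e3] at e2
    exact mul_pos (p_pos n) (by linarith)

lemma IX_lt (hsupp : P (Set.Icc 0 1) = 1) (hinv : Invariant P) {g h : ℝ → ℝ} (hg : Continuous g)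
    (hh : Continuous h) (H : ∀ x, 0 ≤ x → x ≤ 1 → g x ≤ h x) {ε : ℝ} (hε : ε = 0 ∨ ε = 1)
    (h0 : g ε < h ε) : IX P g < IX P h := by
  have e := IX_pos hsupp hinv (f := fun x => 0 + 1 * h x + (-1) * g x) (by fun_prop)
    (fun x h0 h1 => by have := H x h0 h1; linarith) hε (by linarith)
  rw [IX_lin hsupp _ _ _ hh hg] at e
  linarith

lemma dd_pos {α : Finset ℝ} (hα : α.Nonempty) {e : ℝ} (he : e ∉ α) : 0 < dd (α : Set ℝ) e := by
  obtain ⟨m, hm, hmin⟩ := Finset.exists_min_image α (fun a => (e - a) ^ 2) hα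
  have h1 : (e - m) ^ 2 ≤ dd (α : Set ℝ) e :=
    le_dd (by exact_mod_cast hα) fun a ha => hmin a (by exact_mod_cast ha)
  have : e - m ≠ 0 := fun h => he (by rw [sub_eq_zero.1 h]; exact hm)
  have : 0 < (e - m) ^ 2 := by positivity
  linarith

lemma impr (hsupp : P (Set.Icc 0 1) = 1) (hinv : Invariant P) {α β : Finset ℝ} (hα : α.Nonempty)
    {m : ℕ} {ε : ℝ} (hε : ε = 0 ∨ ε = 1) (h1 : S (m + 1) ε ∈ β) (h2 : S (m + 1) ε ∉ α)
    (h : ∀ i x, 0 ≤ x → x ≤ 1 → dd (β : Set ℝ) (S (i + 1) x) ≤ dd (α : Set ℝ) (S (i + 1) x)) :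
    IX P (dd (β : Set ℝ)) < IX P (dd (α : Set ℝ)) := by
  have hβ : β.Nonempty := ⟨_, h1⟩
  refine hasSum_lt (i := m) (fun i => ?_) ?_ (IX_hasSum hsupp hinv (dd_cont β hβ))
    (IX_hasSum hsupp hinv (dd_cont α hα))
  · exact mul_le_mul_of_nonneg_left (IX_mono hsupp _ _ (Fn.cont_phi hβ (S_cont i))
      (Fn.cont_phi hα (S_cont i)) (h i)) (p_pos i).le
  · refine mul_lt_mul_of_pos_left (IX_lt hsupp hinv (Fn.cont_phi hβ (S_cont m))
      (Fn.cont_phi hα (S_cont m)) (h m) hε ?_) (p_pos m)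
    have e1 := dd_le (s := (β : Set ℝ)) (by exact_mod_cast h1) (S (m + 1) ε)
    have e2 := dd_pos hα h2
    norm_num at e1
    linarith

lemma S_gap (i j : ℕ) {x : ℝ} (h0 : 0 ≤ x) (h1 : x ≤ 1) :
    S (j + 1) x ≤ S (i + 1) 1 ∨ S (i + 1 + 1) 0 ≤ S (j + 1) x := by
  rw [S_eq, S_eq, S_eq]
  rcases le_or_gt j i with h | h
  · left
    have e := pow_le_pow_of_le_one (show (0 : ℝ) ≤ 1 / 2 by norm_num) (by norm_num) h
    have := (pow_half_mem i).1
    nlinarith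
  · right
    have e := pow_le_pow_of_le_one (show (0 : ℝ) ≤ 1 / 2 by norm_num) (by norm_num) (Nat.succ_le_of_lt h)
    have := (pow_half_mem j).1
    simp only [Nat.succ_eq_add_one] at e
    nlinarith

lemma exists_new (α : Finset ℝ) : ∃ m, S (m + 1) 0 ∉ α := by
  have inj : Function.Injective (fun m : ℕ => S (m + 1) 0) := fun a b h => by
    simp only [S_eq] at h
    have h' : ((1 : ℝ) / 2) ^ a = (1 / 2) ^ b := by linarith
    exact pow_right_injective₀ (by norm_num) (by norm_num) h'
  obtain ⟨y, ⟨m, rfl⟩, hm⟩ := (Set.infinite_range_of_injective inj).exists_notMem_finset α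
  exact ⟨m, hm⟩

lemma exists_new' (α : Finset ℝ) (m : ℕ) {ε : ℝ} (hε : ε = 0 ∨ ε = 1) :
    ∃ m' ε', (ε' = 0 ∨ ε' = 1) ∧ S (m' + 1) ε' ∉ α ∧
      (S (m + 1) ε ∈ α ∨ S (m + 1) ε = S (m' + 1) ε') := by
  by_cases h : S (m + 1) ε ∈ α
  · obtain ⟨m', hm'⟩ := exists_new α
    exact ⟨m', 0, Or.inl rfl, hm', Or.inl h⟩
  · exact ⟨m, ε, hε, h, Or.inr rfl⟩

variable {α : Finset ℝ}

lemma abs_aux3 {t c b : ℝ} (h1 : c ≤ t) (h2 : b ≤ c) : |t - c| ≤ |t - b| := by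
  rw [abs_of_nonneg (by linarith), abs_of_nonneg (by linarith)]
  linarith

lemma abs_aux4 {t a b : ℝ} (h1 : b < a) (h2 : a + b ≤ 2 * t) : |t - a| ≤ |t - b| := by
  rw [abs_of_nonneg (a := t - b) (by linarith), abs_le]
  constructor <;> linarith

lemma gapL (hsupp : P (Set.Icc 0 1) = 1) (hinv : Invariant P) (hα : α.Nonempty)
    (opt : ∀ β : Finset ℝ, β.Nonempty → β.card ≤ α.card →
      IX P (dd (α : Set ℝ)) ≤ IX P (dd (β : Set ℝ)))
    (i : ℕ) {b : ℝ} (hb : b ∈ α) (_hb0 : S (i + 1) 1 < b) (hb1 : b < S (i + 1 + 1) 0) :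
    ∀ a ∈ α, a < b → a + b < 2 * S (i + 1) 1 := by
  intro a ha hab
  by_contra! hcon
  obtain ⟨m, ε, hε, hnew, hv⟩ := exists_new' α (i + 1) (ε := 0) (Or.inl rfl)
  set e := S (m + 1) ε with he
  set β := insert e (α.erase b) with hβ
  have hc : β.card ≤ α.card := by
    have e1 := Finset.card_insert_le e (α.erase b)
    have e2 := Finset.card_erase_add_one hb
    rw [hβ]; omega
  have me : e ∈ β := by simp [hβ]
  have ma : a ∈ β := by simp [hβ, ha, hab.ne]
  have mv : S (i + 1 + 1) 0 ∈ β := by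
    rcases hv with h | h
    · simp [hβ, h, hb1.ne']
    · rw [h]; exact me
  refine absurd (impr hsupp hinv hα hε me hnew fun j x h0 h1 => ?_) (not_lt.2 (opt β ⟨e, me⟩ hc))
  refine dd_mono (by exact_mod_cast hα) fun c hc => ?_
  by_cases hcb : c = b
  · rw [hcb]
    rcases S_gap i j h0 h1 with h | h
    · exact ⟨a, ma, Opt.abs_aux2 hab (by linarith)⟩
    · exact ⟨_, mv, abs_aux3 h hb1.le⟩
  · exact ⟨c, by simp [hβ] at hc ⊢; tauto, le_rfl⟩

lemma gapR (hsupp : P (Set.Icc 0 1) = 1) (hinv : Invariant P) (hα : α.Nonempty)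
    (opt : ∀ β : Finset ℝ, β.Nonempty → β.card ≤ α.card →
      IX P (dd (α : Set ℝ)) ≤ IX P (dd (β : Set ℝ)))
    (i : ℕ) {b : ℝ} (hb : b ∈ α) (hb0 : S (i + 1) 1 < b) (_hb1 : b < S (i + 1 + 1) 0) :
    ∀ a ∈ α, b < a → 2 * S (i + 1 + 1) 0 < b + a := by
  intro a ha hab
  by_contra! hcon
  obtain ⟨m, ε, hε, hnew, hv⟩ := exists_new' α i (ε := 1) (Or.inr rfl)
  set e := S (m + 1) ε with he
  set β := insert e (α.erase b) with hβ
  have hc : β.card ≤ α.card := by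
    have e1 := Finset.card_insert_le e (α.erase b)
    have e2 := Finset.card_erase_add_one hb
    rw [hβ]; omega
  have me : e ∈ β := by simp [hβ]
  have ma : a ∈ β := by simp [hβ, ha, hab.ne']
  have mv : S (i + 1) 1 ∈ β := by
    rcases hv with h | h
    · simp [hβ, h, hb0.ne]
    · rw [h]; exact me
  refine absurd (impr hsupp hinv hα hε me hnew fun j x h0 h1 => ?_) (not_lt.2 (opt β ⟨e, me⟩ hc))
  refine dd_mono (by exact_mod_cast hα) fun c hc => ?_
  by_cases hcb : c = b
  · rw [hcb]
    rcases S_gap i j h0 h1 with h | h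
    · exact ⟨_, mv, Opt.abs_aux1 h hb0.le⟩
    · exact ⟨a, ma, abs_aux4 hab (by linarith)⟩
  · exact ⟨c, by simp [hβ] at hc ⊢; tauto, le_rfl⟩

end gaps

/-! ## Rescaling -/

def ell (w t : ℝ) : ℝ := 1 - w * (1 - t)
def lv (w x : ℝ) : ℝ := 1 - (1 - x) / w

lemma ell_lv {w : ℝ} (hw : 0 < w) (x : ℝ) : ell w (lv w x) = x := by
  unfold ell lv; field_simp; ring

lemma lv_ell {w : ℝ} (hw : 0 < w) (x : ℝ) : lv w (ell w x) = x := by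
  unfold ell lv; field_simp; ring

lemma dd_scale {w : ℝ} (hw : 0 < w) {β : Set ℝ} (hβ : β.Nonempty) (x : ℝ) :
    dd (ell w '' β) x = w ^ 2 * dd β (lv w x) := by
  have key : ∀ b, (x - ell w b) ^ 2 = w ^ 2 * (lv w x - b) ^ 2 := fun b => by
    unfold ell lv; field_simp; ring
  apply le_antisymm
  · have : dd (ell w '' β) x / w ^ 2 ≤ dd β (lv w x) := le_dd hβ fun b hb => by
      rw [div_le_iff₀ (by positivity)]
      have := dd_le (Set.mem_image_of_mem (ell w) hb) x
      rw [key] at this; linarith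
    rw [div_le_iff₀ (by positivity)] at this
    linarith
  · refine le_dd (hβ.image _) ?_
    rintro _ ⟨b, hb, rfl⟩
    rw [key]
    exact mul_le_mul_of_nonneg_left (dd_le hb _) (by positivity)

section rescale
variable {P : Measure ℝ} [IsProbabilityMeasure P]

variable (P) in
def Lam (K : ℕ) (h : ℝ → ℝ) : ℝ :=
  (∑ j ∈ Finset.range K, p (j + 1) * IX P (fun x => h (lv ((1 / 2) ^ (K + 1)) (S (j + 1) x))))
    / (3 / 4 * (1 / 2) ^ K)

lemma lv_cont (w : ℝ) : Continuous (lv w) := by unfold lv; fun_prop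

lemma IX_scaled (hsupp : P (Set.Icc 0 1) = 1) (hinv : Invariant P) (K : ℕ) {β : Finset ℝ}
    (hβ : β.Nonempty) :
    IX P (dd ((β.image (ell ((1 / 2) ^ (K + 1))) : Finset ℝ) : Set ℝ)) =
      ((1 / 2) ^ (K + 1)) ^ 2 * (3 / 4 * (1 / 2) ^ K) * (Lam P K (dd (β : Set ℝ))
        + p (K + 1) / (3 / 4 * (1 / 2) ^ K) * IX P (fun x => dd (β : Set ℝ) (x / 2 - 1))
        + IT P (dd (β : Set ℝ))) := by
  have hw : (0 : ℝ) < (1 / 2) ^ (K + 1) := by positivity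
  have h1 : dd ((β.image (ell ((1 / 2) ^ (K + 1))) : Finset ℝ) : Set ℝ) =
      fun x => ((1 / 2) ^ (K + 1)) ^ 2 * dd (β : Set ℝ) (lv ((1 / 2) ^ (K + 1)) x) := by
    funext x
    rw [Finset.coe_image, dd_scale hw (by exact_mod_cast hβ)]
  have h2 : IX P (dd ((β.image (ell ((1 / 2) ^ (K + 1))) : Finset ℝ) : Set ℝ)) =
      ((1 / 2) ^ (K + 1)) ^ 2 * IX P (fun x => dd (β : Set ℝ) (lv ((1 / 2) ^ (K + 1)) x)) := by
    rw [h1]; simp only [IX]; rw [integral_const_mul]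
  rw [h2, IX_decomp hsupp hinv K (Fn.cont_phi hβ (lv_cont _))]
  have e1 : ∀ x, lv ((1 / 2) ^ (K + 1)) (S (K + 1) x) = x / 2 - 1 := fun x => by
    rw [S_eq, lv, pow_succ]; field_simp; ring
  have e2 : ∀ t, lv ((1 / 2) ^ (K + 1)) (1 - (1 / 2) ^ (K + 1) * (1 - t)) = t := lv_ell hw
  simp only [e1, e2]
  unfold Lam
  have : (0 : ℝ) < (1 / 2) ^ K := by positivity
  have e3 : IT P (fun t => dd (β : Set ℝ) t) = IT P (dd (β : Set ℝ)) := rfl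
  rw [e3]
  field_simp

theorem opt_scaled (hsupp : P (Set.Icc 0 1) = 1) (hinv : Invariant P) (K : ℕ) {α : Finset ℝ}
    (hα : α.Nonempty)
    (opt : ∀ β : Finset ℝ, β.Nonempty → β.card ≤ α.card →
      IX P (dd (α : Set ℝ)) ≤ IX P (dd (β : Set ℝ))) :
    Opt (IX P) (IT P) (Lam P K) (p (K + 1) / (3 / 4 * (1 / 2) ^ K))
      (α.image (lv ((1 / 2) ^ (K + 1)))) := by
  have hw : (0 : ℝ) < (1 / 2) ^ (K + 1) := by positivity
  have hK : (0 : ℝ) < (1 / 2) ^ K := by positivity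
  have hα' : (α.image (lv ((1 / 2) ^ (K + 1)))).Nonempty := hα.image _
  have himg : (α.image (lv ((1 / 2) ^ (K + 1)))).image (ell ((1 / 2) ^ (K + 1))) = α := by
    rw [Finset.image_image]
    have : ell ((1 / 2) ^ (K + 1)) ∘ lv ((1 / 2) ^ (K + 1)) = id := funext fun x => ell_lv hw x
    rw [this, Finset.image_id]
  have hcard : (α.image (lv ((1 / 2) ^ (K + 1)))).card = α.card :=
    Finset.card_image_of_injective _ fun x y h => by
      rw [← ell_lv hw x, ← ell_lv hw y, h]
  have tr : ∀ b, b ∈ α.image (lv ((1 / 2) ^ (K + 1))) → ell ((1 / 2) ^ (K + 1)) b ∈ α := fun b hb => by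
    obtain ⟨x, hx, rfl⟩ := Finset.mem_image.1 hb
    rwa [ell_lv hw]
  have lt_ell : ∀ {a b : ℝ}, a < b → ell ((1 / 2) ^ (K + 1)) a < ell ((1 / 2) ^ (K + 1)) b :=
    fun h => by unfold ell; nlinarith
  have gapsL : ∀ (i : ℕ) (u v : ℝ), S (i + 1) 1 = ell ((1 / 2) ^ (K + 1)) u →
      S (i + 1 + 1) 0 = ell ((1 / 2) ^ (K + 1)) v → ∀ b ∈ α.image (lv ((1 / 2) ^ (K + 1))), u < b →
      b < v → ∀ a ∈ α.image (lv ((1 / 2) ^ (K + 1))), a < b → a + b < 2 * u := by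
    intro i u v hu hv b hb h1 h2 a ha hab
    have := gapL hsupp hinv hα opt i (tr b hb) (by rw [hu]; exact lt_ell h1)
      (by rw [hv]; exact lt_ell h2) _ (tr a ha) (lt_ell hab)
    rw [hu] at this
    unfold ell at this
    by_contra! hcon
    nlinarith
  have gapsR : ∀ (i : ℕ) (u v : ℝ), S (i + 1) 1 = ell ((1 / 2) ^ (K + 1)) u →
      S (i + 1 + 1) 0 = ell ((1 / 2) ^ (K + 1)) v → ∀ b ∈ α.image (lv ((1 / 2) ^ (K + 1))), u < b →
      b < v → ∀ a ∈ α.image (lv ((1 / 2) ^ (K + 1))), b < a → 2 * v < b + a := by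
    intro i u v hu hv b hb h1 h2 a ha hab
    have := gapR hsupp hinv hα opt i (tr b hb) (by rw [hu]; exact lt_ell h1)
      (by rw [hv]; exact lt_ell h2) _ (tr a ha) (lt_ell hab)
    rw [hv] at this
    unfold ell at this
    by_contra! hcon
    nlinarith
  have u0 : S (K + 1) 1 = ell ((1 / 2) ^ (K + 1)) (-1 / 2) := by rw [S_eq, ell]; ring
  have v0 : S (K + 1 + 1) 0 = ell ((1 / 2) ^ (K + 1)) 0 := by rw [S_eq, ell, zero_div]
  have u1 : S (K + 1 + 1) 1 = ell ((1 / 2) ^ (K + 1)) (1 / 4) := by rw [S_eq, ell]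
  have v1 : S (K + 1 + 1 + 1) 0 = ell ((1 / 2) ^ (K + 1)) (1 / 2) := by rw [S_eq, ell]; ring
  have u2 : S (K + 1 + 1 + 1) 1 = ell ((1 / 2) ^ (K + 1)) (5 / 8) := by rw [S_eq, ell]; ring
  have v2 : S (K + 1 + 1 + 1 + 1) 0 = ell ((1 / 2) ^ (K + 1)) (3 / 4) := by rw [S_eq, ell]; ring
  exact {
    ne := hα'
    opt := fun β hβ hc => by
      have e := opt (β.image (ell ((1 / 2) ^ (K + 1)))) (hβ.image _)
        (Finset.card_image_le.trans (by omega))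
      conv_lhs at e => rw [← himg]
      rw [IX_scaled hsupp hinv K hα', IX_scaled hsupp hinv K hβ] at e
      exact le_of_mul_le_mul_left e (by positivity)
    mono := fun β hβ h => by
      unfold Lam
      refine div_le_div_of_nonneg_right (Finset.sum_le_sum fun j hj => ?_) (by positivity)
      have c1 := S_cont j
      have c2 := lv_cont ((1 / 2) ^ (K + 1))
      refine mul_le_mul_of_nonneg_left (IX_mono hsupp _ _ (Fn.cont_phi hβ (by fun_prop))
        (Fn.cont_phi hα' (by fun_prop)) fun x h0 h1 => h _ ?_) (p_pos j).le
      have hj' : j + 1 ≤ K := Finset.mem_range.1 hj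
      have e := pow_le_pow_of_le_one (show (0 : ℝ) ≤ 1 / 2 by norm_num) (by norm_num) hj'
      rw [S_eq, lv]
      have : 2 ≤ (1 - (1 - (1 / 2 : ℝ) ^ j * (1 - x / 4))) / (1 / 2) ^ (K + 1) := by
        rw [le_div_iff₀ hw]
        rw [pow_succ] at e ⊢
        have := (pow_half_mem j).1
        nlinarith
      linarith
    rho := by
      rw [le_div_iff₀ (by positivity)]
      cases K with
      | zero => rw [p_zero]; norm_num
      | succ m => rw [p_succ]; nlinarith [(pow_half_mem (m + 1)).1]
    g0 := fun b hb h1 h2 a ha hab => by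
      have := gapsL K _ _ u0 v0 b hb h1 h2 a ha hab; linarith
    g1l := fun b hb h1 h2 a ha hab => by
      have := gapsL (K + 1) _ _ u1 v1 b hb h1 h2 a ha hab; linarith
    g1r := fun b hb h1 h2 a ha hab => by
      have := gapsR (K + 1) _ _ u1 v1 b hb h1 h2 a ha hab; linarith
    g2l := fun b hb h1 h2 a ha hab => by
      have := gapsL (K + 1 + 1) _ _ u2 v2 b hb h1 h2 a ha hab; linarith
    g2r := fun b hb h1 h2 a ha hab => by
      have := gapsR (K + 1 + 1) _ _ u2 v2 b hb h1 h2 a ha hab; linarith }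

end rescale
/-- If `α` is an optimal set of `n`-means (`n ≥ 2`) with `card(α ∩ J_{(k,∞)}) ≥ 2` for some
`k ≥ 1`, then `α ∩ J_{k+1} ≠ ∅`, `α ∩ J_{(k+1,∞)} ≠ ∅`, `α` contains no point of
`(S_{k+1}(1), S_{k+2}(0))`, and the Voronoi separation properties hold. -/
theorem stmt_13 (P : Measure ℝ) [IsProbabilityMeasure P]
    (hsupp : P (Set.Icc 0 1) = 1) (hinv : Invariant P)
    (n : ℕ) (hn : 2 ≤ n) (α : Set ℝ) (hopt : IsOptimal P n α)
    (k : ℕ) (hk : 1 ≤ k) (hcard : 2 ≤ (α ∩ Jinf [k]).ncard) :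
    (α ∩ Jw [k + 1]).Nonempty ∧ (α ∩ Jinf [k + 1]).Nonempty ∧
    (∀ x ∈ α, x ∉ Set.Ioo (S (k + 1) 1) (S (k + 2) 0)) ∧
    (∀ a ∈ α ∩ Jw [k + 1], Jinf [k + 1] ∩ voronoi α a = ∅) ∧
    (∀ a ∈ α ∩ Jinf [k + 1], Jw [k + 1] ∩ voronoi α a = ∅) := by
  obtain ⟨K, rfl⟩ : ∃ K, k = K + 1 := ⟨k - 1, by omega⟩
  obtain ⟨hα1, hαn, hαq⟩ := hopt
  have hfin : α.Finite := Set.finite_of_ncard_pos (by omega)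
  obtain ⟨A, rfl⟩ : ∃ A : Finset ℝ, α = (A : Set ℝ) := ⟨hfin.toFinset, by simp⟩
  rw [Set.ncard_coe_finset] at hα1 hαn
  have hA : A.Nonempty := Finset.card_pos.1 hα1
  have opt : ∀ β : Finset ℝ, β.Nonempty → β.card ≤ A.card →
      IX P (dd (A : Set ℝ)) ≤ IX P (dd (β : Set ℝ)) := fun β hβ hc => by
    have e1 : distortion P (A : Set ℝ) = IX P (dd (A : Set ℝ)) := rfl
    have e2 : distortion P (β : Set ℝ) = IX P (dd (β : Set ℝ)) := rfl
    rw [← e1, ← e2, hαq]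
    refine csInf_le ⟨0, ?_⟩ ⟨β, ?_, ?_, rfl⟩
    · rintro _ ⟨γ, -, -, rfl⟩
      exact integral_nonneg fun x => Real.iInf_nonneg fun a => sq_nonneg _
    · rw [Set.ncard_coe_finset]; exact Finset.card_pos.2 hβ
    · rw [Set.ncard_coe_finset]; omega
  have F := fn hsupp hinv
  have O := opt_scaled hsupp hinv K hA opt
  set w : ℝ := (1 / 2) ^ (K + 1) with hw
  have hw0 : 0 < w := by positivity
  set B := A.image (lv w) with hB
  have toB : ∀ x ∈ (A : Set ℝ), lv w x ∈ B := fun x hx =>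
    Finset.mem_image_of_mem _ (by exact_mod_cast hx)
  have toA : ∀ t ∈ B, ell w t ∈ (A : Set ℝ) := fun t ht => by
    obtain ⟨x, hx, rfl⟩ := Finset.mem_image.1 ht
    rw [ell_lv hw0]; exact_mod_cast hx
  -- description of the intervals in the rescaled coordinate
  have Sl : ∀ j y, S (K + 1 + j + 1) y = ell w (1 - (1 / 2) ^ j * (1 - y / 4)) := fun j y => by
    rw [S_eq, ell, hw, pow_add _ (K + 1) j]; ring
  have J1 : ∀ x ∈ Jw [K + 1 + 1], 0 ≤ lv w x ∧ lv w x ≤ 1 / 4 := by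
    rintro _ ⟨y, ⟨h0, h1⟩, rfl⟩
    have : Sw [K + 1 + 1] y = ell w (1 - (1 / 2) ^ 0 * (1 - y / 4)) := Sl 0 y
    rw [this, lv_ell hw0]
    constructor <;> norm_num <;> linarith
  have J1' : ∀ t, 0 ≤ t → t ≤ 1 / 4 → ell w t ∈ Jw [K + 1 + 1] := fun t h0 h1 => by
    refine ⟨4 * t, ⟨by linarith, by linarith⟩, ?_⟩
    have : Sw [K + 1 + 1] (4 * t) = ell w (1 - (1 / 2) ^ 0 * (1 - 4 * t / 4)) := Sl 0 _
    rw [this]; congr 1; ring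
  have J2 : ∀ x ∈ Jinf [K + 1 + 1], 1 / 2 ≤ lv w x := by
    intro x hx
    obtain ⟨j, y, ⟨h0, h1⟩, rfl⟩ := Set.mem_iUnion.1 hx
    have : Sw (wext [K + 1 + 1] (j + 1)) y = S (K + 1 + (j + 1) + 1) y := by
      rw [show K + 1 + (j + 1) + 1 = K + 1 + 1 + (j + 1) by ring]; rfl
    rw [this, Sl, lv_ell hw0, pow_succ]
    have := pow_half_mem j
    nlinarith
  have J2' : ∀ t, 1 / 2 ≤ t → t ≤ 5 / 8 → ell w t ∈ Jinf [K + 1 + 1] := fun t h0 h1 => by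
    refine Set.mem_iUnion.2 ⟨0, 8 * t - 4, ⟨by linarith, by linarith⟩, ?_⟩
    have : Sw (wext [K + 1 + 1] (0 + 1)) (8 * t - 4) = S (K + 1 + 1 + 1) (8 * t - 4) := rfl
    refine (this.trans (Sl 1 _)).trans ?_; congr 1; ring
  have J0 : ∀ x ∈ Jinf [K + 1], (0 ≤ lv w x ∧ lv w x ≤ 1 / 4) ∨
      (x ∈ Jinf [K + 1 + 1] ∧ 1 / 2 ≤ lv w x) := by
    intro x hx
    obtain ⟨j, hj⟩ := Set.mem_iUnion.1 hx
    cases j with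
    | zero => exact Or.inl (J1 x hj)
    | succ j =>
      have e : x ∈ Jinf [K + 1 + 1] := by
        refine Set.mem_iUnion.2 ⟨j, ?_⟩
        have : wext [K + 1 + 1] (j + 1) = wext [K + 1] (j + 1 + 1) := by
          simp only [wext, wlast, List.dropLast_singleton, List.nil_append, List.getLastD_cons,
            List.getLastD_nil]
          congr 1; ring
        rw [this]; exact hj
      exact Or.inr ⟨e, J2 x e⟩
  obtain ⟨z1, hz1, z2, hz2, hne⟩ := (Set.one_lt_ncard (hfin.inter_of_left _)).1
    (show 1 < ((A : Set ℝ) ∩ Jinf [K + 1]).ncard by omega)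
  have hne' : lv w z1 ≠ lv w z2 := fun h => hne (by rw [← ell_lv hw0 z1, ← ell_lv hw0 z2, h])
  have hA' : ∃ a ∈ B, 0 ≤ a ∧ a ≤ 1 / 4 := by
    rcases J0 z1 hz1.2 with h1 | ⟨-, h1⟩
    · exact ⟨_, toB _ hz1.1, h1⟩
    rcases J0 z2 hz2.2 with h2 | ⟨-, h2⟩
    · exact ⟨_, toB _ hz2.1, h2⟩
    exact O.claimA F (toB _ hz1.1) (toB _ hz2.1) hne' h1 h2
  have hgap : ∀ b ∈ B, b ≤ 1 / 4 ∨ 1 / 2 ≤ b := by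
    obtain ⟨a0, ha0, h0, h1⟩ := hA'
    have hz : ∀ z ∈ (A : Set ℝ) ∩ Jinf [K + 1], a0 ≠ lv w z → ∀ b ∈ B, b ≤ 1 / 4 ∨ 1 / 2 ≤ b :=
      fun z hz hn => by
        rcases J0 z hz.2 with h | ⟨-, h⟩
        · exact O.claimC F ha0 (toB _ hz.1) hn h0 h1 h.1 (Or.inl h.2)
        · exact O.claimC F ha0 (toB _ hz.1) hn h0 h1 (by linarith) (Or.inr h)
    by_cases h : a0 = lv w z1
    · exact hz z2 hz2 (by rw [h]; exact hne')
    · exact hz z1 hz1 h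
  have hD : ((A : Set ℝ) ∩ Jinf [K + 1 + 1]).Nonempty := by
    rcases J0 z1 hz1.2 with h1 | ⟨h1, -⟩
    swap
    · exact ⟨z1, hz1.1, h1⟩
    rcases J0 z2 hz2.2 with h2 | ⟨h2, -⟩
    swap
    · exact ⟨z2, hz2.1, h2⟩
    have : ∃ c ∈ B, 1 / 2 ≤ c ∧ c ≤ 5 / 8 := by
      rcases lt_or_gt_of_ne hne' with h | h
      · exact O.claimD F hgap (toB _ hz1.1) (toB _ hz2.1) h1.1 h h2.2
      · exact O.claimD F hgap (toB _ hz2.1) (toB _ hz1.1) h2.1 h h1.2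
    obtain ⟨c, hc, hc1, hc2⟩ := this
    exact ⟨ell w c, toA c hc, J2' c hc1 hc2⟩
  obtain ⟨r, hrA, hrJ⟩ := id hD
  have habs : ∀ x y, |x - y| = w * |lv w x - lv w y| := fun x y => by
    rw [← abs_of_pos hw0, ← abs_mul, abs_of_pos hw0]; congr 1; unfold lv; field_simp; ring
  refine ⟨?_, hD, ?_, ?_, ?_⟩
  · obtain ⟨a, ha, h0, h1⟩ := hA'
    exact ⟨ell w a, toA a ha, J1' a h0 h1⟩
  · rintro x hx ⟨h1, h2⟩
    have e1 := Sl 0 1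
    have e2 := Sl 1 0
    have e1' : S (K + 1 + 1) 1 = ell w (1 - (1 / 2) ^ 0 * (1 - 1 / 4)) := e1
    have e2' : S (K + 1 + 2) 0 = ell w (1 - (1 / 2) ^ 1 * (1 - 0 / 4)) := e2
    rw [e1'] at h1
    rw [e2'] at h2
    rw [← ell_lv hw0 x] at h1 h2
    have := hgap _ (toB x hx)
    unfold ell at h1 h2
    rcases this with h | h <;> nlinarith
  · rintro a ⟨haA, haJ⟩
    rw [Set.eq_empty_iff_forall_notMem]
    rintro x ⟨hxJ, hxV⟩
    obtain ⟨c, hc, hc1, hc2⟩ := O.lemE1 F hgap hA' (toB _ hrA) (J2 r hrJ)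
    have := hxV _ (toA c hc)
    rw [habs x a, habs x (ell w c), lv_ell hw0] at this
    have := le_of_mul_le_mul_left this hw0
    have ha := J1 a haJ
    have hx := J2 x hxJ
    rw [abs_of_nonneg (a := lv w x - lv w a) (by linarith)] at this
    rcases le_abs'.1 this with h | h <;> linarith
  · rintro a ⟨haA, haJ⟩
    rw [Set.eq_empty_iff_forall_notMem]
    rintro x ⟨hxJ, hxV⟩
    obtain ⟨c, hc, hc0, hc1, hc2⟩ := O.lemE2 F hgap hA' (toB _ haA) (J2 a haJ)
    have := hxV _ (toA c hc)
    rw [habs x a, habs x (ell w c), lv_ell hw0] at this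
    have := le_of_mul_le_mul_left this hw0
    have ha := J2 a haJ
    have hx := J1 x hxJ
    rw [abs_sub_comm, abs_of_nonneg (a := lv w a - lv w x) (by linarith)] at this
    rcases le_abs'.1 this with h | h <;> linarith
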